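/- arXiv:0810.3133 — 4 statements merged into one kernel-verified Lean document; each statement's English description precedes it below -/
import Mathlib

section
/- If G is a non-complete double-critical k-chromatic graph, then every vertex of G has degree at least k+1, i.e. δ(G) ≥ k+1. -/
open SimpleGraph

/-- A graph is vertex-critical if deleting any vertex decreases the chromatic number. -/
def VertexCritical {V : Type} (G : SimpleGraph V) : Prop :=
  ∀ v : V, (G.induce ({v}ᶜ : Set V)).chromaticNumber < G.chromaticNumber

/-- A vertex-critical graph is double-critical if deleting the two end-vertices of any
edge decreases the chromatic number by at least two. -/
def DoubleCritical {V : Type} (G : SimpleGraph V) : Prop :=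
  VertexCritical G ∧
  ∀ x y : V, G.Adj x y →
    (G.induce ({x, y}ᶜ : Set V)).chromaticNumber + 2 ≤ G.chromaticNumber


open Classical in
/-- If `G` is not `n`-colorable, every `n`-coloring of `G - v` uses every color on the
neighborhood of `v`. -/
theorem exists_adj_color_eq {V : Type} {G : SimpleGraph V} {n : ℕ} (hG : ¬ G.Colorable n)
    {v : V} (C : (G.induce ({v}ᶜ : Set V)).Coloring (Fin n)) (i : Fin n) :
    ∃ w : ({v}ᶜ : Set V), G.Adj v w ∧ C w = i := by
  by_contra! h
  refine hG ⟨Coloring.mk (fun w => if hw : w = v then i else C ⟨w, hw⟩) ?_⟩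
  intro a b hab
  by_cases ha : a = v <;> by_cases hb : b = v
  · exact absurd (ha.trans hb.symm) hab.ne
  · subst ha
    simpa [hb] using (h ⟨b, hb⟩ hab).symm
  · subst hb
    simpa [ha] using h ⟨a, ha⟩ hab.symm
  · simpa [ha, hb] using C.valid (v := ⟨a, ha⟩) (w := ⟨b, hb⟩) hab

open Classical in
/-- If `G` is not `(n + 1)`-colorable and `x ≠ y`, every `n`-coloring of `G - x - y` uses every
color on the common neighborhood of `x` and `y`. -/
theorem exists_common_neighbor_color_eq {V : Type} {G : SimpleGraph V} {n : ℕ}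
    (hG : ¬ G.Colorable (n + 1)) {x y : V} (hxy : x ≠ y)
    (C : (G.induce ({x, y}ᶜ : Set V)).Coloring (Fin n)) (i : Fin n) :
    ∃ w : ({x, y}ᶜ : Set V), G.Adj x w ∧ G.Adj y w ∧ C w = i := by
  by_contra! h
  let f : V → Option (Fin n) := fun w =>
    if hw : w ∈ ({x, y}ᶜ : Set V) then
      if C ⟨w, hw⟩ = i ∧ G.Adj x w then none else some (C ⟨w, hw⟩)
    else if w = x then some i else none
  have fx : f x = some i := by simp [f]
  have fy : f y = none := by simp [f, hxy.symm]
  have fw (w : ({x, y}ᶜ : Set V)) :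
      f w = if C w = i ∧ G.Adj x w then none else some (C w) := by
    simp only [f, Subtype.coe_prop, dite_true]
  have key (w : ({x, y}ᶜ : Set V)) : (G.Adj x w → f w ≠ f x) ∧ (G.Adj y w → f w ≠ f y) := by
    have := h w
    rw [fw, fx, fy]
    constructor <;> intro hw <;> split_ifs <;> simp <;> tauto
  have hval : ∀ {a b : V}, G.Adj a b → f a ≠ f b := by
    intro a b hab
    by_cases ha : a ∈ ({x, y}ᶜ : Set V) <;> by_cases hb : b ∈ ({x, y}ᶜ : Set V)
    · have hC : C ⟨a, ha⟩ ≠ C ⟨b, hb⟩ := C.valid (v := ⟨a, ha⟩) (w := ⟨b, hb⟩) hab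
      rw [fw ⟨a, ha⟩, fw ⟨b, hb⟩]
      split_ifs <;> simp <;> grind
    · have hb' : b = x ∨ b = y := by simpa [or_iff_not_imp_left] using hb
      rcases hb' with rfl | rfl
      · exact (key ⟨a, ha⟩).1 hab.symm
      · exact (key ⟨a, ha⟩).2 hab.symm
    · have ha' : a = x ∨ a = y := by simpa [or_iff_not_imp_left] using ha
      rcases ha' with rfl | rfl
      · exact ((key ⟨b, hb⟩).1 hab).symm
      · exact ((key ⟨b, hb⟩).2 hab).symm
    · have ha' : a = x ∨ a = y := by simpa [or_iff_not_imp_left] using ha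
      have hb' : b = x ∨ b = y := by simpa [or_iff_not_imp_left] using hb
      have := hab.ne
      rcases ha' with rfl | rfl <;> rcases hb' with rfl | rfl <;> simp_all
  exact hG (by simpa using (Coloring.mk f hval).colorable)

/-- A function taking every value in `Fin n` on members of a finset `s` forces `n ≤ #s`. -/
theorem le_card_of_forall_exists_eq {V : Type} {t : Set V} {n : ℕ} (C : t → Fin n)
    (s : Finset V) (h : ∀ i, ∃ w : t, (w : V) ∈ s ∧ C w = i) : n ≤ s.card := by
  choose g hg hC using h
  have hinj : Set.InjOn (fun i => (g i : V)) (Finset.univ : Finset (Fin n)) := by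
    intro i _ j _ hij
    rw [← hC i, ← hC j, Subtype.ext hij]
  simpa using Finset.card_le_card_of_injOn (fun i => (g i : V)) (fun i _ => hg i) hinj

open Classical in
/-- In a vertex-critical graph that is not `n`-colorable but whose vertex-deleted subgraphs all
are, a vertex whose neighborhood is a clique forces the graph to be complete. -/
theorem eq_top_of_isClique_neighborSet {V : Type} [Fintype V] {G : SimpleGraph V} {n : ℕ}
    (hG : ¬ G.Colorable n) (hdel : ∀ u : V, (G.induce ({u}ᶜ : Set V)).Colorable n) {v : V}
    (hv : G.IsClique (G.neighborSet v)) : G = ⊤ := by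
  have hdeg : n ≤ G.degree v := by
    obtain ⟨C⟩ := hdel v
    rw [← card_neighborFinset_eq_degree]
    exact le_card_of_forall_exists_eq C _ fun i => by
      simpa using exists_adj_color_eq hG C i
  have hclique : G.IsClique (insert v (G.neighborSet v)) :=
    hv.insert fun b hb _ => hb
  have hall : ∀ u, u ∈ insert v (G.neighborSet v) := by
    by_contra! ⟨u, hu⟩
    obtain ⟨C⟩ := hdel u
    let S : Finset V := insert v (G.neighborFinset v)
    have hS (w : S) : (w : V) ∈ insert v (G.neighborSet v) := by
      have := w.2
      simp only [S, Finset.mem_insert, mem_neighborFinset] at this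
      exact this
    have hSu (w : S) : (w : V) ∈ ({u}ᶜ : Set V) := fun h => hu (h ▸ hS w)
    have hinj : Function.Injective fun w : S => C ⟨w, hSu w⟩ := by
      intro a b hab
      by_contra hne
      exact C.valid (v := ⟨a, hSu a⟩) (w := ⟨b, hSu b⟩)
        (hclique (hS a) (hS b) fun h => hne (Subtype.ext h)) hab
    have hcard := Fintype.card_le_of_injective _ hinj
    have : S.card = G.degree v + 1 := by simp [S]
    simp only [Fintype.card_coe, Fintype.card_fin] at hcard
    omega
  ext a b
  exact ⟨fun h => h.ne, fun h => hclique (hall a) (hall b) h⟩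

/-- Every vertex of a non-complete double-critical `k`-chromatic graph has degree
at least `k + 1`, i.e. `δ(G) ≥ k + 1`. -/
theorem stmt7 {V : Type} [Fintype V] (G : SimpleGraph V) [DecidableRel G.Adj] (k : ℕ)
    (hnc : G ≠ ⊤) (hdc : DoubleCritical G) (hchrom : G.chromaticNumber = k) :
    ∀ v : V, k + 1 ≤ G.degree v := by
  classical
  intro v
  obtain ⟨hvc, hec⟩ := hdc
  have hncol (m : ℕ) (hm : m < k) : ¬ G.Colorable m := fun h => by
    have := h.chromaticNumber_le
    rw [hchrom] at this
    exact absurd (by exact_mod_cast this) hm.not_ge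
  have hdel (u : V) : (G.induce ({u}ᶜ : Set V)).Colorable (k - 1) := by
    rw [← chromaticNumber_le_iff_colorable]
    have := hvc u
    rw [hchrom] at this
    lift (G.induce ({u}ᶜ : Set V)).chromaticNumber to ℕ using this.ne_top with m
    norm_cast at this ⊢
    omega
  have hk : 0 < k := by
    have := hvc v
    rw [hchrom] at this
    exact_mod_cast pos_of_gt this
  have hedge (x y : V) (h : G.Adj x y) :
      2 ≤ k ∧ (G.induce ({x, y}ᶜ : Set V)).Colorable (k - 2) := by
    rw [← chromaticNumber_le_iff_colorable]
    have := hec x y h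
    rw [hchrom] at this
    have hfin : (G.induce ({x, y}ᶜ : Set V)).chromaticNumber ≠ ⊤ := by
      intro htop
      simp [htop] at this
    lift (G.induce ({x, y}ᶜ : Set V)).chromaticNumber to ℕ using hfin with m
    norm_cast at this ⊢
    omega
  have hnclique : ¬ G.IsClique (G.neighborSet v) := fun h =>
    hnc (eq_top_of_isClique_neighborSet (hncol (k - 1) (by omega)) hdel h)
  obtain ⟨y, hy, z, hz, hyz, hnadj⟩ : ∃ y, G.Adj v y ∧ ∃ z, G.Adj v z ∧ y ≠ z ∧ ¬ G.Adj y z := by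
    simpa [SimpleGraph.IsClique, Set.Pairwise] using hnclique
  obtain ⟨hk2, ⟨C⟩⟩ := hedge v y hy
  have hn : ¬ G.Colorable (k - 2 + 1) := hncol _ (by omega)
  have hzmem : z ∈ ({v, y}ᶜ : Set V) := by simp [hz.ne', hyz.symm]
  obtain ⟨w, hvw, hyw, hCw⟩ := exists_common_neighbor_color_eq hn hy.ne C (C ⟨z, hzmem⟩)
  have hzw : ¬ G.Adj z w := fun h => C.valid (v := ⟨z, hzmem⟩) (w := w) h hCw.symm
  have hwz : (w : V) ≠ z := fun h => hnadj (h ▸ hyw)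
  obtain ⟨-, ⟨D⟩⟩ := hedge v z hz
  have hle : k - 2 ≤ (G.neighborFinset v \ {z, y, (w : V)}).card := by
    refine le_card_of_forall_exists_eq D _ fun i => ?_
    obtain ⟨u, hvu, hzu, hDu⟩ := exists_common_neighbor_color_eq hn hz.ne D i
    refine ⟨u, ?_, hDu⟩
    have h1 : (u : V) ≠ z := hzu.ne'
    have h2 : (u : V) ≠ y := fun h => hnadj (h ▸ hzu).symm
    have h3 : (u : V) ≠ w := fun h => hzw (h ▸ hzu)
    simp [hvu, h1, h2, h3]
  have hsub : {z, y, (w : V)} ⊆ G.neighborFinset v := by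
    intro a ha
    simp only [Finset.mem_insert, Finset.mem_singleton] at ha
    rcases ha with rfl | rfl | rfl <;> simpa
  have hthree : ({z, y, (w : V)} : Finset V).card = 3 :=
    Finset.card_eq_three.2 ⟨z, y, w, hyz.symm, hwz.symm, hyw.ne, rfl⟩
  have := Finset.card_le_card hsub
  rw [Finset.card_sdiff_of_subset hsub, hthree, card_neighborFinset_eq_degree] at hle
  rw [hthree, card_neighborFinset_eq_degree] at this
  omega
end

section
/- If G is a 4-critical non-complete graph, then G contains at most m(G)/2 double-critical edges, where m(G) is the number of edges of G. Moreover, G contains exactly m(G)/2 double-critical edges if and only if G has a vertex v adjacent to all other vertices of G such that G − v is an odd cycle of length at least 5. -/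
open SimpleGraph

/-- An edge `e` of `G` is double-critical if deleting its two end-vertices decreases the
chromatic number by exactly two. -/
def IsDoubleCriticalEdge {V : Type} (G : SimpleGraph V) (e : Sym2 V) : Prop :=
  ∃ x y : V, e = s(x, y) ∧ G.Adj x y ∧
    (G.induce ({x, y}ᶜ : Set V)).chromaticNumber + 2 = G.chromaticNumber

namespace SimpleGraph

variable {V : Type*} {G : SimpleGraph V}

/-- `G` is properly coloured by `c` outside of the vertex set `s`. -/
def ProperOff {α : Type*} (G : SimpleGraph V) (s : Set V) (c : V → α) : Prop :=
  ∀ ⦃u w⦄, u ∉ s → w ∉ s → G.Adj u w → c u ≠ c w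

lemma colorable_induce_compl_iff {k : ℕ} (s : Set V) :
    (G.induce sᶜ).Colorable (k + 1) ↔ ∃ c : V → Fin (k + 1), G.ProperOff s c := by
  classical
  constructor
  · rintro ⟨C⟩
    refine ⟨fun u ↦ if h : u ∈ sᶜ then C ⟨u, h⟩ else 0, fun u w hu hw huw ↦ ?_⟩
    have hu' : u ∈ sᶜ := hu
    have hw' : w ∈ sᶜ := hw
    simp only [hu', hw', dite_true]
    exact C.valid (by simpa using huw)
  · rintro ⟨c, hc⟩
    exact ⟨Coloring.mk (fun u ↦ c u) fun {u w} huw ↦ hc u.2 w.2 (by simpa using huw)⟩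

lemma ProperOff.colorable {k : ℕ} {c : V → Fin k} (h : G.ProperOff ∅ c) : G.Colorable k :=
  ⟨Coloring.mk c fun {_ _} huw ↦ h (by simp) (by simp) huw⟩

/-- Restoring a deleted vertex costs at most one additional colour. -/
lemma ProperOff.exists_succ {k : ℕ} {s : Set V} {v : V} {c : V → Fin k}
    (h : G.ProperOff (insert v s) c) : ∃ d : V → Fin (k + 1), G.ProperOff s d := by
  classical
  have hlast : ∀ a : Fin k, a.castSucc ≠ Fin.last k := fun a ↦ (Fin.castSucc_lt_last a).ne
  refine ⟨fun u ↦ if u = v then Fin.last k else (c u).castSucc, fun u w hu hw huw hd ↦ ?_⟩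
  by_cases huv : u = v <;> by_cases hwv : w = v <;> simp only [huv, hwv, if_true, if_false] at hd
  · exact huw.ne (huv.trans hwv.symm)
  · exact hlast _ hd.symm
  · exact hlast _ hd
  · exact h (by simp [*]) (by simp [*]) huw (Fin.castSucc_injective k hd)

/-- In a proper colouring of `G - v` that does not extend to `G`, every colour occurs in the
neighbourhood of `v`. -/
lemma ProperOff.exists_adj {k : ℕ} {v : V} {c : V → Fin k} (h : G.ProperOff {v} c)
    (hk : ¬ G.Colorable k) (a : Fin k) : ∃ w, G.Adj v w ∧ c w = a := by
  classical
  by_contra! hcon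
  refine hk (ProperOff.colorable (c := Function.update c v a) fun u w _ _ huw ↦ ?_)
  by_cases hu : u = v
  · subst hu
    rw [Function.update_self, Function.update_of_ne huw.ne']
    exact (hcon w huw).symm
  · by_cases hw : w = v
    · subst hw
      rw [Function.update_self, Function.update_of_ne hu]
      exact hcon u huw.symm
    · rw [Function.update_of_ne hu, Function.update_of_ne hw]
      exact h hu hw huw

lemma ProperOff.le_degree {k : ℕ} {v : V} [Fintype (G.neighborSet v)] {c : V → Fin k}
    (h : G.ProperOff {v} c) (hk : ¬ G.Colorable k) : k ≤ G.degree v := by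
  classical
  have hsub : (Finset.univ : Finset (Fin k)) ⊆ (G.neighborFinset v).image c := fun a _ ↦ by
    obtain ⟨w, hw, rfl⟩ := h.exists_adj hk a
    exact Finset.mem_image_of_mem c (by simpa using hw)
  simpa using (Finset.card_le_card hsub).trans Finset.card_image_le

/-- If `G - x - y` is `k`-coloured for an edge `xy` of a graph that is not `(k + 1)`-colourable,
then each colour occurs on a common neighbour of `x` and `y`. -/
lemma ProperOff.exists_common_neighbor {k : ℕ} {x y : V} {c : V → Fin k}
    (h : G.ProperOff {x, y} c) (hk : ¬ G.Colorable (k + 1)) (i : Fin k) :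
    ∃ u, G.Adj x u ∧ G.Adj y u ∧ c u = i := by
  classical
  by_contra! hcon
  let d : V → Fin (k + 1) := fun u ↦
    if u = x then i.castSucc else if u = y then Fin.last k else
      if c u = i ∧ G.Adj x u then Fin.last k else (c u).castSucc
  have hne : ∀ a : Fin k, a.castSucc ≠ Fin.last k := fun a ↦ (Fin.castSucc_lt_last a).ne
  have key : ∀ u w, G.Adj u w → d u = d w → u ≠ x → w ≠ x → u ≠ y → w ≠ y → False := by
    intro u w huw hd hux hwx huy hwy
    have hc := h (u := u) (w := w) (by simp [*]) (by simp [*]) huw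
    simp only [d, hux, hwx, huy, hwy, if_false] at hd
    split_ifs at hd with h1 h2 h2
    · exact hc (h1.1.trans h2.1.symm)
    · exact hne _ hd.symm
    · exact hne _ hd
    · exact hc (Fin.castSucc_injective k hd)
  have keyx : ∀ w, G.Adj x w → d x ≠ d w := by
    intro w hw hd
    have hwx := hw.ne'
    simp only [d, hwx, if_false, if_true] at hd
    split_ifs at hd with h1 h2
    · exact hne _ hd
    · exact hne _ hd
    · exact h2 ⟨(Fin.castSucc_injective k hd).symm, hw⟩
  have keyy : ∀ w, G.Adj y w → d y ≠ d w := by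
    intro w hw hd
    by_cases hwx : w = x
    · subst hwx; exact keyx y hw.symm hd.symm
    by_cases hyx : y = x
    · subst hyx; exact keyx w hw hd
    have hwy := hw.ne'
    simp only [d, hwx, hwy, hyx, if_false, if_true] at hd
    split_ifs at hd with h1
    · exact hcon w h1.2 hw h1.1
    · exact hne _ hd.symm
  refine hk (ProperOff.colorable (c := d) fun u w _ _ huw hd ↦ ?_)
  by_cases hux : u = x
  · subst hux; exact keyx w huw hd
  by_cases hwx : w = x
  · subst hwx; exact keyx u huw.symm hd.symm
  by_cases huy : u = y
  · subst huy; exact keyy w huw hd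
  by_cases hwy : w = y
  · subst hwy; exact keyy u huw.symm hd.symm
  exact key u w huw hd hux hwx huy hwy

/-- Pairwise intersecting edges either share a vertex or there are at most three of them. -/
lemma ncard_le_three_or_exists_forall_mem {D : Set (Sym2 V)}
    (hD : ∀ e ∈ D, ¬ e.IsDiag) (h : ∀ e ∈ D, ∀ f ∈ D, ∃ v, v ∈ e ∧ v ∈ f) :
    D.ncard ≤ 3 ∨ ∃ x, ∀ e ∈ D, x ∈ e := by
  classical
  by_contra! hcon
  obtain ⟨hcard, hx⟩ := hcon
  have hne : D.Nonempty := by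
    by_contra h0
    simp [Set.not_nonempty_iff_eq_empty.1 h0] at hcard
  obtain ⟨e, he⟩ := hne
  induction e with | h x y =>
  obtain ⟨f, hf, hxf⟩ := hx x
  obtain ⟨g, hg, hyg⟩ := hx y
  have hyf : y ∈ f := by
    obtain ⟨v, hv, hv'⟩ := h _ he _ hf
    rcases Sym2.mem_iff.1 hv with rfl | rfl
    exacts [absurd hv' hxf, hv']
  have hxg : x ∈ g := by
    obtain ⟨v, hv, hv'⟩ := h _ he _ hg
    rcases Sym2.mem_iff.1 hv with rfl | rfl
    exacts [hv', absurd hv' hyg]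
  obtain ⟨z, rfl⟩ := Sym2.mem_iff_exists.1 hyf
  obtain ⟨z', rfl⟩ := Sym2.mem_iff_exists.1 hxg
  have hz : z' = z := by
    obtain ⟨v, hv, hv'⟩ := h _ hf _ hg
    simp only [Sym2.mem_iff, not_or] at hv hv' hxf hyg
    grind
  subst hz
  have hsub : D ⊆ ({s(x, y), s(y, z'), s(x, z')} : Finset (Sym2 V)) := by
    intro e' he'
    have h1 := h _ he _ he'
    have h2 := h _ hf _ he'
    have h3 := h _ hg _ he'
    have h4 := hD _ he'
    have h5 := hD _ he
    have h6 := hD _ hf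
    have h7 := hD _ hg
    induction e' with | h a b =>
    simp only [Sym2.mem_iff, Sym2.mk_isDiag_iff, Finset.coe_insert, Finset.coe_singleton,
      Set.mem_insert_iff, Set.mem_singleton_iff, Sym2.eq_iff] at *
    grind
  have h3 := Set.ncard_le_ncard hsub (Finset.finite_toSet _)
  rw [Set.ncard_coe_finset] at h3
  exact absurd (h3.trans Finset.card_le_three) (by lia)

lemma ncard_neighborSet_cycleGraph {n : ℕ} (hn : 3 ≤ n) (i : Fin n) :
    ((cycleGraph n).neighborSet i).ncard = 2 := by
  obtain ⟨n, rfl⟩ := Nat.exists_eq_add_of_le' hn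
  have := cycleGraph_degree_three_le (v := i)
  rwa [← card_neighborSet_eq_degree, ← Nat.card_eq_fintype_card, Nat.card_coe_set_eq] at this

/-- A graph of maximum degree at most two which is not bipartite, but all of whose
vertex-deleted subgraphs are, is an odd cycle. -/
lemma exists_iso_cycleGraph [Finite V] (hdeg : ∀ v, (G.neighborSet v).ncard ≤ 2)
    (hcol : ¬ G.Colorable 2) (hcrit : ∀ v, ∃ c : V → Fin 2, G.ProperOff {v} c) :
    ∃ n, Odd n ∧ 3 ≤ n ∧ Nonempty (G ≃g cycleGraph n) := by
  classical
  have hcyc : ¬ G.IsAcyclic := fun h ↦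
    hcol (chromaticNumber_le_iff_colorable.1 h.chromaticNumber_le_two)
  rw [isAcyclic_iff_free_cycleGraph] at hcyc
  push Not at hcyc
  obtain ⟨n, hn, hfree⟩ := hcyc
  obtain ⟨f⟩ : (cycleGraph n).IsContained G := hfree
  have hinj : Function.Injective f := f.injective
  have hclosed : ∀ i w, G.Adj (f i) w → ∃ j, (cycleGraph n).Adj i j ∧ f j = w := by
    intro i w hw
    have hsub : f '' (cycleGraph n).neighborSet i ⊆ G.neighborSet (f i) := by
      rintro _ ⟨j, hj, rfl⟩
      exact f.toHom.map_adj hj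
    have hc : (f '' (cycleGraph n).neighborSet i).ncard = 2 := by
      rw [Set.ncard_image_of_injective _ hinj]
      exact ncard_neighborSet_cycleGraph hn i
    have heq := Set.eq_of_subset_of_ncard_le hsub (by rw [hc]; exact hdeg _) (Set.toFinite _)
    have : w ∈ f '' (cycleGraph n).neighborSet i := heq ▸ hw
    exact this
  have hsurj : Function.Surjective f := by
    by_contra hns
    obtain ⟨y, hy⟩ := not_forall.1 hns
    obtain ⟨c₁, hc₁⟩ := hcrit y
    obtain ⟨c₂, hc₂⟩ := hcrit (f ⟨0, by lia⟩)
    refine hcol (ProperOff.colorable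
      (c := fun u ↦ if u ∈ Set.range f then c₁ u else c₂ u) fun u w _ _ huw ↦ ?_)
    have hiff : u ∈ Set.range f ↔ w ∈ Set.range f := by
      constructor
      · rintro ⟨i, rfl⟩
        obtain ⟨j, -, hj⟩ := hclosed i w huw
        exact ⟨j, hj⟩
      · rintro ⟨i, rfl⟩
        obtain ⟨j, -, hj⟩ := hclosed i u huw.symm
        exact ⟨j, hj⟩
    by_cases hu : u ∈ Set.range f
    · have hw := hiff.1 hu
      simp only [hu, hw, if_true]
      refine hc₁ ?_ ?_ huw
      · rintro rfl; exact hy hu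
      · rintro rfl; exact hy hw
    · have hw : w ∉ Set.range f := fun h ↦ hu (hiff.2 h)
      simp only [hu, hw, if_false]
      refine hc₂ ?_ ?_ huw
      · rintro rfl; exact hu ⟨_, rfl⟩
      · rintro rfl; exact hw ⟨_, rfl⟩
  let φ : cycleGraph n ≃g G :=
    { toEquiv := Equiv.ofBijective f ⟨hinj, hsurj⟩
      map_rel_iff' := by
        intro i j
        refine ⟨fun h ↦ ?_, fun h ↦ f.toHom.map_adj h⟩
        obtain ⟨k, hk, hkj⟩ := hclosed i (f j) h
        rwa [← hinj hkj] }
  refine ⟨n, ?_, hn, ⟨φ.symm⟩⟩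
  by_contra hodd
  have := chromaticNumber_cycleGraph_of_even n (by lia) (Nat.not_odd_iff_even.1 hodd)
  exact hcol ((chromaticNumber_le_iff_colorable.1 this.le).of_hom φ.symm.toHom)

/-- Deleting a vertex from a cycle leaves a bipartite graph. -/
lemma exists_properOff_cycleGraph {n : ℕ} (i : Fin n) :
    ∃ c : Fin n → Fin 2, (cycleGraph n).ProperOff {i} c := by
  have : NeZero n := ⟨by rintro rfl; exact i.elim0⟩
  refine ⟨fun j ↦ Fin.ofNat 2 (j - i).val, fun j k hj hk hjk h ↦ ?_⟩
  have hj0 : (j - i).val ≠ 0 := by simpa [sub_eq_zero] using hj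
  have hk0 : (k - i).val ≠ 0 := by simpa [sub_eq_zero] using hk
  have step : ∀ a b : Fin n, (a - b).val = 1 → a.val ≠ 0 → a.val = b.val + 1 := by
    intro a b hab ha
    rw [Fin.sub_def] at hab
    simp only at hab
    have := a.2
    have := b.2
    rcases Nat.lt_or_ge (n - b + a) n with hlt | hge
    · rw [Nat.mod_eq_of_lt hlt] at hab; lia
    · rw [Nat.mod_eq_sub_mod hge, Nat.mod_eq_of_lt (by lia)] at hab; lia
  simp only [Fin.ext_iff, Fin.ofNat] at h
  rcases cycleGraph_adj'.1 hjk with h1 | h1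
  · have := step (j - i) (k - i) (by simpa using h1) hj0
    lia
  · have := step (k - i) (j - i) (by simpa using h1) hk0
    lia

lemma adj_of_card_le_degree_add_one [Fintype V] {v w : V} [Fintype (G.neighborSet v)]
    (h : Fintype.card V ≤ G.degree v + 1) (hw : w ≠ v) : G.Adj v w := by
  classical
  have hsub : G.neighborFinset v ⊆ Finset.univ.erase v := fun u hu ↦ by
    simpa using ((mem_neighborFinset ..).1 hu).ne'
  have heq := Finset.eq_of_subset_of_card_le hsub (by
    rw [Finset.card_erase_of_mem (Finset.mem_univ v), Finset.card_univ, card_neighborFinset_eq_degree]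
    lia)
  have : w ∈ Finset.univ.erase v := by simpa using hw
  rwa [← heq, mem_neighborFinset] at this

lemma eq_top_of_isClique_four (hcrit : ∀ v, ∃ c : V → Fin 3, G.ProperOff {v} c) {x y u v : V}
    (hxy : G.Adj x y) (hxu : G.Adj x u) (hxv : G.Adj x v) (hyu : G.Adj y u) (hyv : G.Adj y v)
    (huv : G.Adj u v) : G = ⊤ := by
  have hall : ∀ w, w = x ∨ w = y ∨ w = u ∨ w = v := by
    intro w
    by_contra! hw
    obtain ⟨hwx, hwy, hwu, hwv⟩ := hw
    obtain ⟨c, hc⟩ := hcrit w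
    have h1 := hc hwx.symm hwy.symm hxy
    have h2 := hc hwx.symm hwu.symm hxu
    have h3 := hc hwx.symm hwv.symm hxv
    have h4 := hc hwy.symm hwu.symm hyu
    have h5 := hc hwy.symm hwv.symm hyv
    have h6 := hc hwu.symm hwv.symm huv
    lia
  ext a b
  have := hall a
  have := hall b
  have := G.adj_comm
  simp only [top_adj]
  constructor
  · exact Adj.ne
  · grind

/-- If `G - s` is bipartite, then every triangle of `G` meets `s`. -/
lemma ProperOff.mem_of_triangle {s : Set V} {c : V → Fin 2} (h : G.ProperOff s c) {x y u : V}
    (hxy : G.Adj x y) (hxu : G.Adj x u) (hyu : G.Adj y u) : x ∈ s ∨ y ∈ s ∨ u ∈ s := by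
  by_contra! hcon
  obtain ⟨hx, hy, hu⟩ := hcon
  have h1 := h hx hy hxy
  have h2 := h hx hu hxu
  have h3 := h hy hu hyu
  lia

/-- In a non-complete 4-vertex-critical graph, any two edges whose deletion (together with
their ends) leaves a bipartite graph intersect. -/
lemma exists_mem_of_properOff (h3 : ¬ G.Colorable 3)
    (hcrit : ∀ v, ∃ c : V → Fin 3, G.ProperOff {v} c) (hnc : G ≠ ⊤) {x y a b : V}
    (hxy : G.Adj x y) (hab : G.Adj a b) {c d : V → Fin 2} (hc : G.ProperOff {x, y} c)
    (hd : G.ProperOff {a, b} d) : ∃ v, v ∈ s(x, y) ∧ v ∈ s(a, b) := by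
  by_contra! hcon
  obtain ⟨u, hxu, hyu, hu⟩ := hc.exists_common_neighbor h3 0
  obtain ⟨v, hxv, hyv, hv⟩ := hc.exists_common_neighbor h3 1
  have huv : u ≠ v := by
    rintro rfl
    simp [hu] at hv
  have hnadj : ¬ G.Adj u v := fun h ↦
    hnc (eq_top_of_isClique_four hcrit hxy hxu hxv hyu hyv h)
  have h1 := hd.mem_of_triangle hxy hxu hyu
  have h2 := hd.mem_of_triangle hxy hxv hyv
  have := G.adj_comm
  simp only [Sym2.mem_iff, Set.mem_insert_iff, Set.mem_singleton_iff] at *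
  grind

end SimpleGraph

lemma VertexCritical.exists_properOff {V : Type} {G : SimpleGraph V} (hcrit : VertexCritical G)
    {k : ℕ} (hchrom : G.chromaticNumber = (k + 2 : ℕ)) (v : V) :
    ∃ c : V → Fin (k + 1), G.ProperOff {v} c := by
  rw [← colorable_induce_compl_iff, ← chromaticNumber_le_iff_colorable]
  have := hcrit v
  rw [hchrom] at this
  exact Order.le_of_lt_add_one (by exact_mod_cast this)

lemma isDoubleCriticalEdge_iff {V : Type} {G : SimpleGraph V} (hchrom : G.chromaticNumber = 4)
    (x y : V) : IsDoubleCriticalEdge G s(x, y) ↔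
      G.Adj x y ∧ ∃ c : V → Fin 2, G.ProperOff {x, y} c := by
  have h3 : ¬ G.Colorable 3 := fun h ↦ by
    have := h.chromaticNumber_le
    rw [hchrom] at this
    exact absurd this (by decide)
  have key : ∀ x y, G.Adj x y → ((G.induce ({x, y}ᶜ : Set V)).chromaticNumber + 2 =
      G.chromaticNumber ↔ ∃ c : V → Fin 2, G.ProperOff {x, y} c) := by
    intro x y hxy
    rw [← colorable_induce_compl_iff, ← chromaticNumber_le_iff_colorable, hchrom]
    have h4 : (4 : ℕ∞) = 2 + 2 := by norm_num
    rw [h4, (ENat.add_left_injective_of_ne_top (n := 2) (by simp)).eq_iff]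
    refine ⟨fun h ↦ h.le, fun h ↦ le_antisymm h ?_⟩
    by_contra! hlt
    have h1 : (G.induce ({x, y}ᶜ : Set V)).chromaticNumber ≤ (1 : ℕ) :=
      Order.le_of_lt_add_one (by exact_mod_cast hlt)
    rw [chromaticNumber_le_iff_colorable, colorable_induce_compl_iff] at h1
    obtain ⟨c, hc⟩ := h1
    obtain ⟨d, hd⟩ := hc.exists_succ
    rw [← insert_empty_eq y] at hd
    obtain ⟨e, he⟩ := hd.exists_succ
    exact h3 he.colorable
  constructor
  · rintro ⟨x', y', he, hadj, h⟩
    have h' := (key x' y' hadj).1 h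
    rcases Sym2.eq_iff.1 he with ⟨rfl, rfl⟩ | ⟨rfl, rfl⟩
    · exact ⟨hadj, h'⟩
    · rw [Set.pair_comm]
      exact ⟨hadj.symm, h'⟩
  · rintro ⟨hadj, h⟩
    exact ⟨x, y, rfl, hadj, (key x y hadj).2 h⟩

/-- A `4`-critical non-complete graph `G` contains at most `m(G)/2` double-critical edges;
moreover it contains exactly `m(G)/2` double-critical edges if and only if `G` has a vertex
`v` adjacent to all other vertices such that `G - v` is an odd cycle of length at least `5`. -/
theorem stmt14 {V : Type} [Fintype V] (G : SimpleGraph V)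
    (hcrit : VertexCritical G) (hchrom : G.chromaticNumber = 4) (hnc : G ≠ ⊤) :
    2 * {e ∈ G.edgeSet | IsDoubleCriticalEdge G e}.ncard ≤ G.edgeSet.ncard ∧
    (2 * {e ∈ G.edgeSet | IsDoubleCriticalEdge G e}.ncard = G.edgeSet.ncard ↔
      ∃ v : V, (∀ u : V, u ≠ v → G.Adj v u) ∧
        ∃ n : ℕ, Odd n ∧ 5 ≤ n ∧
          Nonempty ((G.induce ({v}ᶜ : Set V)) ≃g SimpleGraph.cycleGraph n)) := by
  classical
  have h3 : ¬ G.Colorable 3 := fun h ↦ by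
    have := h.chromaticNumber_le
    rw [hchrom] at this
    exact absurd this (by decide)
  have hdel := fun v ↦ hcrit.exists_properOff (k := 2) hchrom v
  have hiff := isDoubleCriticalEdge_iff hchrom
  have hdeg : ∀ v, 3 ≤ G.degree v := fun v ↦ (hdel v).choose_spec.le_degree h3
  have hcard : 5 ≤ Fintype.card V := by
    by_contra! hlt
    refine hnc (SimpleGraph.ext_iff.2 ?_)
    ext v w
    exact ⟨Adj.ne, fun h ↦ adj_of_card_le_degree_add_one (by have := hdeg v; lia) h.symm⟩
  have hedge : G.edgeSet.ncard = G.edgeFinset.card := by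
    rw [← coe_edgeFinset, Set.ncard_coe_finset]
  have hsum := G.sum_degrees_eq_twice_card_edges
  rw [← hedge] at hsum
  set D := {e ∈ G.edgeSet | IsDoubleCriticalEdge G e}
  have hsplit : ∀ v, G.degree v + ∑ w ∈ Finset.univ.erase v, G.degree w = 2 * G.edgeSet.ncard :=
    fun v ↦ by rw [← hsum, Finset.add_sum_erase _ (fun w ↦ G.degree w) (Finset.mem_univ v)]
  have hothers : ∀ v, 3 * (Fintype.card V - 1) ≤ ∑ w ∈ Finset.univ.erase v, G.degree w := by
    intro v
    have := Finset.card_nsmul_le_sum (Finset.univ.erase v) (fun w ↦ G.degree w) 3 fun w _ ↦ hdeg w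
    rw [Finset.card_erase_of_mem (Finset.mem_univ v), Finset.card_univ, smul_eq_mul] at this
    lia
  have hinc : ∀ v, (G.incidenceSet v).ncard = G.degree v := fun v ↦ by
    rw [← card_incidenceSet_eq_degree, ← Nat.card_eq_fintype_card, Nat.card_coe_set_eq]
  have hlt : ∀ v, G.degree v ≤ Fintype.card V - 1 := fun v ↦ by
    have := G.degree_lt_card_verts v
    lia
  have hD : D.ncard ≤ 3 ∨ ∃ x, ∀ e ∈ D, x ∈ e := by
    refine ncard_le_three_or_exists_forall_mem (fun e he ↦ G.not_isDiag_of_mem_edgeSet he.1) ?_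
    rintro e ⟨-, he⟩ f ⟨-, hf⟩
    induction e with | h x y =>
    induction f with | h a b =>
    obtain ⟨hxy, c, hc⟩ := (hiff x y).1 he
    obtain ⟨hab, d, hd⟩ := (hiff a b).1 hf
    exact exists_mem_of_properOff h3 hdel hnc hxy hab hc hd
  have hstar : ∀ x, (∀ e ∈ D, x ∈ e) → D ⊆ G.incidenceSet x := fun x hx e he ↦ ⟨he.1, hx e he⟩
  have hbound : 2 * D.ncard ≤ G.edgeSet.ncard ∧
      (2 * D.ncard = G.edgeSet.ncard → ∃ x, ∀ e ∈ D, x ∈ e) := by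
    rcases hD with hD | ⟨x, hx⟩
    · obtain ⟨v⟩ : Nonempty V := Fintype.card_pos_iff.1 (by lia)
      have := hsplit v
      have := hothers v
      have := hdeg v
      exact ⟨by lia, fun _ ↦ by lia⟩
    · have h1 := Set.ncard_le_ncard (hstar x hx) (Set.toFinite _)
      have := hsplit x
      have := hothers x
      have := hlt x
      rw [hinc] at h1
      exact ⟨by lia, fun _ ↦ ⟨x, hx⟩⟩
  refine ⟨hbound.1, fun heq ↦ ?_, ?_⟩
  · obtain ⟨x, hx⟩ := hbound.2 heq
    have h1 := Set.ncard_le_ncard (hstar x hx) (Set.toFinite _)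
    have h2 := hsplit x
    have h4 := hothers x
    have h5 := hlt x
    rw [hinc] at h1
    have hDeq : D = G.incidenceSet x :=
      Set.eq_of_subset_of_ncard_le (hstar x hx) (by rw [hinc]; lia) (Set.toFinite _)
    have hdom : ∀ u, u ≠ x → G.Adj x u := fun u hu ↦
      adj_of_card_le_degree_add_one (by lia) hu
    have hthree : ∀ w, w ≠ x → G.degree w = 3 := by
      have := (Finset.sum_eq_sum_iff_of_le (s := Finset.univ.erase x) (f := fun _ ↦ 3)
        (g := fun w ↦ G.degree w) fun w _ ↦ hdeg w).1 (by
          rw [Finset.sum_const, Finset.card_erase_of_mem (Finset.mem_univ x), Finset.card_univ,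
            smul_eq_mul]
          lia)
      exact fun w hw ↦ (this w (by simpa using hw)).symm
    refine ⟨x, hdom, ?_⟩
    have hcycle : ∃ n, Odd n ∧ 3 ≤ n ∧ Nonempty (G.induce ({x}ᶜ : Set V) ≃g cycleGraph n) := by
      refine exists_iso_cycleGraph ?_ ?_ ?_
      · intro v
        have hsub : Subtype.val '' (G.induce ({x}ᶜ : Set V)).neighborSet v ⊆
            G.neighborSet v \ {x} := by
          rintro _ ⟨w, hw, rfl⟩
          exact ⟨by simpa using hw, w.2⟩
        have hle := Set.ncard_le_ncard hsub (Set.toFinite _)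
        rw [Set.ncard_image_of_injective _ Subtype.val_injective,
          Set.ncard_sdiff_singleton_of_mem (by exact (hdom v v.2).symm)] at hle
        have := hthree v v.2
        rw [← card_neighborSet_eq_degree, ← Nat.card_eq_fintype_card, Nat.card_coe_set_eq] at this
        lia
      · intro h
        obtain ⟨c, hc⟩ := (colorable_induce_compl_iff {x}).1 h
        rw [← insert_empty_eq x] at hc
        obtain ⟨d, hd⟩ := hc.exists_succ
        exact h3 hd.colorable
      · intro v
        have hv : s(x, v.1) ∈ D := hDeq ▸ ⟨hdom v v.2, Sym2.mem_mk_left _ _⟩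
        obtain ⟨-, c, hc⟩ := (hiff _ _).1 hv.2
        refine ⟨fun u ↦ c u, fun u w hu hw huw ↦ hc ?_ ?_ (by simpa using huw)⟩
        · rintro (h | h)
          exacts [u.2 h, hu (Subtype.ext h)]
        · rintro (h | h)
          exacts [w.2 h, hw (Subtype.ext h)]
    obtain ⟨n, hodd, hn, ⟨φ⟩⟩ := hcycle
    refine ⟨n, hodd, ?_, ⟨φ⟩⟩
    have hn' := Fintype.card_congr φ.toEquiv
    rw [Fintype.card_compl_set, Fintype.card_fin, Set.card_singleton] at hn'
    obtain ⟨k, rfl⟩ := hodd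
    lia
  · rintro ⟨x, hdom, n, hodd, hn, ⟨φ⟩⟩
    refine le_antisymm hbound.1 ?_
    have hsub : G.incidenceSet x ⊆ D := by
      rintro e ⟨he, hxe⟩
      obtain ⟨y, rfl⟩ := Sym2.mem_iff_exists.1 hxe
      have hxy : G.Adj x y := he
      refine ⟨he, (hiff x y).2 ⟨hxy, ?_⟩⟩
      obtain ⟨c, hc⟩ := exists_properOff_cycleGraph (φ ⟨y, hxy.ne'⟩)
      refine ⟨fun u ↦ if h : u ∈ ({x}ᶜ : Set V) then c (φ ⟨u, h⟩) else 0, fun u w hu hw huw ↦ ?_⟩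
      simp only [Set.mem_insert_iff, Set.mem_singleton_iff, not_or] at hu hw
      have hux : u ∈ ({x}ᶜ : Set V) := hu.1
      have hwx : w ∈ ({x}ᶜ : Set V) := hw.1
      simp only [hux, hwx, dite_true]
      refine hc ?_ ?_ (φ.map_adj_iff.2 (by simpa using huw))
      · simpa [Subtype.ext_iff] using hu.2
      · simpa [Subtype.ext_iff] using hw.2
    have h1 := Set.ncard_le_ncard hsub (Set.toFinite _)
    rw [hinc] at h1
    have hdegx : Fintype.card V - 1 ≤ G.degree x := by
      rw [← Finset.card_univ, ← Finset.card_erase_of_mem (Finset.mem_univ x),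
        ← card_neighborFinset_eq_degree]
      refine Finset.card_le_card fun u hu ↦ ?_
      simpa using hdom u (Finset.ne_of_mem_erase hu)
    have hthree : ∀ w, w ≠ x → G.degree w ≤ 3 := by
      intro w hw
      have hcover : G.neighborSet w ⊆ insert x ((fun i ↦ (φ.symm i).val) ''
          (cycleGraph n).neighborSet (φ ⟨w, hw⟩)) := by
        intro u hu
        by_cases hux : u = x
        · exact Or.inl hux
        · exact Or.inr ⟨φ ⟨u, hux⟩, φ.map_adj_iff.2 (by simpa using hu), by simp⟩
      have hle := (Set.ncard_le_ncard hcover (Set.toFinite _)).trans (Set.ncard_insert_le _ _)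
      have himg := Set.ncard_image_le (f := fun i ↦ (φ.symm i).val)
        (Set.toFinite ((cycleGraph n).neighborSet (φ ⟨w, hw⟩)))
      rw [ncard_neighborSet_cycleGraph (by lia)] at himg
      rw [← card_neighborSet_eq_degree, ← Nat.card_eq_fintype_card, Nat.card_coe_set_eq]
      lia
    have h2 := hsplit x
    have h4 : ∑ w ∈ Finset.univ.erase x, G.degree w ≤ 3 * (Fintype.card V - 1) := by
      have := Finset.sum_le_card_nsmul (Finset.univ.erase x) (fun w ↦ G.degree w) 3 fun w hw ↦
        hthree w (Finset.ne_of_mem_erase hw)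
      rw [Finset.card_erase_of_mem (Finset.mem_univ x), Finset.card_univ, smul_eq_mul] at this
      lia
    have h5 := hlt x
    lia
end

section
/- Every non-complete double-critical k-chromatic graph with k ≥ 6 is 6-connected. -/
open SimpleGraph

namespace FivePoints

/-- Every unordered pair of distinct indices below five satisfies `P`. -/
def allPairs (P : Fin 5 → Fin 5 → Bool) : Bool :=
  P 0 1 && P 0 2 && P 0 3 && P 0 4 && P 1 2 && P 1 3 && P 1 4 && P 2 3 && P 2 4 && P 3 4

/-- The function on `Fin 5` with the given values. -/
def tuple {α : Type} (a b c d e : α) : Fin 5 → α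
  | 0 => a | 1 => b | 2 => c | 3 => d | 4 => e

/-- The set `J` lies in a single class of the partition given by the fibres of `p`. -/
def inClass (p : Fin 5 → ℕ) (J : Fin 5 → Bool) : Bool :=
  allPairs fun i j => !(J i) || !(J j) || (p i).beq (p j)

/-- Give the elements of `J` the new colour `5`. -/
def recolor (p : Fin 5 → ℕ) (J : Fin 5 → Bool) (i : Fin 5) : ℕ := cond (J i) 5 (p i)

/-- Some subset of `Fin 5` satisfies `P`. -/
def existsSet (P : (Fin 5 → Bool) → Bool) : Bool :=
  [true, false].any fun a => [true, false].any fun b => [true, false].any fun c =>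
  [true, false].any fun d => [true, false].any fun e => P (tuple a b c d e)

/-- Recolouring `p` on `J` and `q` on `K` yields the same partition. -/
def agree (p q : Fin 5 → ℕ) (J K : Fin 5 → Bool) : Bool :=
  allPairs fun i j =>
    !(((recolor p J i).beq (recolor p J j)).xor ((recolor q K i).beq (recolor q K j)))

/-- Some sets `J` and `K`, each monochromatic in `p` or in `q`, make the recoloured partitions agree.
Pairs with `J = K` are tried first. -/
def recolorSearch (p q : Fin 5 → ℕ) : Bool :=
  (existsSet fun J => (inClass p J || inClass q J) && agree p q J J) ||
  existsSet fun J => (inClass p J || inClass q J) &&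
    existsSet fun K => (inClass p K || inClass q K) && agree p q J K

/-- Boolean implication that evaluates its conclusion only if needed. -/
def implies (a b : Bool) : Bool := cond a b true

/-- All functions sending each index to the least element of its class, one for each partition of
`Fin 5`, satisfy `P`. -/
def forallRep (P : (Fin 5 → ℕ) → Bool) : Bool :=
  [0, 1].all fun b => [0, 1, 2].all fun c => implies (implies (c.beq 1) (b.beq 1)) <|
  [0, 1, 2, 3].all fun d => implies (implies (d.beq 1) (b.beq 1) && implies (d.beq 2) (c.beq 2)) <|
  [0, 1, 2, 3, 4].all fun e =>
    implies (implies (e.beq 1) (b.beq 1) && implies (e.beq 2) (c.beq 2) &&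
      implies (e.beq 3) (d.beq 3)) <| P (tuple 0 b c d e)

theorem implies_eq_true (a b : Bool) : implies a b = true ↔ (a = true → b = true) := by
  cases a <;> simp [implies]

theorem forallRep_recolorSearch :
    forallRep (fun p => forallRep fun q => recolorSearch p q) = true := by
  decide +kernel

theorem forall_pairs_of_allPairs {R : Fin 5 → Fin 5 → Prop} (hrefl : ∀ i, R i i)
    (hsymm : ∀ i j, R i j → R j i) {P : Fin 5 → Fin 5 → Bool}
    (hP : ∀ i j, P i j = true → R i j) (h : allPairs P = true) (i j : Fin 5) : R i j := by
  simp only [allPairs, Bool.and_eq_true] at h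
  obtain ⟨⟨⟨⟨⟨⟨⟨⟨⟨h01, h02⟩, h03⟩, h04⟩, h12⟩, h13⟩, h14⟩, h23⟩, h24⟩, h34⟩ := h
  fin_cases i <;> fin_cases j <;>
    first
      | exact hrefl _
      | exact hP _ _ (by assumption)
      | exact hsymm _ _ (hP _ _ (by assumption))

theorem eq_of_inClass {p : Fin 5 → ℕ} {J : Fin 5 → Bool} (h : inClass p J = true) :
    ∀ i j, J i = true → J j = true → p i = p j := by
  refine forall_pairs_of_allPairs (fun _ _ _ => rfl)
    (fun i j h hj hi => (h hi hj).symm) (fun i j h hi hj => ?_) h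
  simpa [hi, hj] using h

theorem recolor_eq_iff {p q : Fin 5 → ℕ} {J K : Fin 5 → Bool} (h : agree p q J K = true) :
    ∀ i j, recolor p J i = recolor p J j ↔ recolor q K i = recolor q K j := by
  refine forall_pairs_of_allPairs (fun _ => by simp) (fun i j h => ?_) (fun i j h => ?_) h
  · rw [eq_comm, h, eq_comm]
  · rw [← Nat.beq_eq, ← Nat.beq_eq]
    generalize (recolor p J i).beq (recolor p J j) = a at *
    generalize (recolor q K i).beq (recolor q K j) = b at *
    revert h
    revert a b
    decide

theorem exists_of_existsSet {P : (Fin 5 → Bool) → Bool} (h : existsSet P = true) :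
    ∃ J, P J = true := by
  simp only [existsSet, List.any_eq_true] at h
  obtain ⟨a, -, b, -, c, -, d, -, e, -, h⟩ := h
  exact ⟨_, h⟩

theorem exists_of_recolorSearch {p q : Fin 5 → ℕ} (h : recolorSearch p q = true) :
    ∃ J K : Fin 5 → Bool, (inClass p J || inClass q J) = true ∧
      (inClass p K || inClass q K) = true ∧ agree p q J K = true := by
  rw [recolorSearch, Bool.or_eq_true] at h
  rcases h with h | h
  · obtain ⟨J, hJ⟩ := exists_of_existsSet h
    rw [Bool.and_eq_true] at hJ
    exact ⟨J, J, hJ.1, hJ.1, hJ.2⟩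
  · obtain ⟨J, hJ⟩ := exists_of_existsSet h
    rw [Bool.and_eq_true] at hJ
    obtain ⟨K, hK⟩ := exists_of_existsSet hJ.2
    rw [Bool.and_eq_true] at hK
    exact ⟨J, K, hJ.1, hK.1, hK.2⟩

theorem exists_of_forallRep {P : (Fin 5 → ℕ) → Bool} (hP : forallRep P = true) {α : Type*}
    (f : Fin 5 → α) :
    ∃ p : Fin 5 → ℕ, P p = true ∧ (∀ i, p i < 5) ∧ ∀ i j, p i = p j ↔ f i = f j := by
  classical
  have hne (i : Fin 5) : (Finset.univ.filter fun j => f j = f i).Nonempty := ⟨i, by simp⟩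
  set r : Fin 5 → Fin 5 := fun i => (Finset.univ.filter fun j => f j = f i).min' (hne i) with hr
  have hle (i : Fin 5) : r i ≤ i := Finset.min'_le _ _ (by simp)
  have hf (i : Fin 5) : f (r i) = f i := by
    simpa using Finset.min'_mem _ (hne i)
  have hcongr {i j : Fin 5} (h : f i = f j) : r i = r j := by
    simp only [hr, h]
  have hguard {i j : Fin 5} (h : r j = i) : r i = i := by
    rw [← hcongr (show f j = f i by rw [← h, hf]), h]
  have htuple : (fun i => (r i : ℕ)) = tuple 0 (r 1 : ℕ) (r 2) (r 3) (r 4) := by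
    funext i
    fin_cases i
    · exact congrArg Fin.val (Fin.le_zero_iff.1 (hle 0))
    all_goals rfl
  have h1 := hle 1
  have h2 := hle 2
  have h3 := hle 3
  have h4 := hle 4
  refine ⟨fun i => r i, ?_, fun i => (r i).isLt, fun i j => ⟨fun h => ?_, fun h => ?_⟩⟩
  · have g21 := @hguard 1 2
    have g31 := @hguard 1 3
    have g32 := @hguard 2 3
    have g41 := @hguard 1 4
    have g42 := @hguard 2 4
    have g43 := @hguard 3 4
    rw [htuple]
    simp only [Fin.ext_iff, Fin.le_def] at *
    simp only [forallRep, List.all_eq_true, implies_eq_true, Bool.and_eq_true, Nat.beq_eq] at hP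
    refine hP (r 1) ?_ (r 2) ?_ g21 (r 3) ?_ ⟨g31, g32⟩ (r 4) ?_ ⟨⟨g41, g42⟩, g43⟩
    all_goals
      simp at *
      omega
  · rw [← hf i, ← hf j, Fin.ext h]
  · exact congrArg Fin.val (hcongr h)

end FivePoints

/-- Any two colourings of at most five points induce the same partition after each of them
receives one new colour on a suitable set that is monochromatic in one of them. -/
theorem exists_common_recoloring {V α β : Type*} (S : Set V) (hfin : S.Finite)
    (hS : S.ncard ≤ 5) (f : V → α) (g : V → β) :
    ∃ J K : Set V, J ⊆ S ∧ K ⊆ S ∧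
      ((∀ x ∈ J, ∀ y ∈ J, f x = f y) ∨ ∀ x ∈ J, ∀ y ∈ J, g x = g y) ∧
      ((∀ x ∈ K, ∀ y ∈ K, f x = f y) ∨ ∀ x ∈ K, ∀ y ∈ K, g x = g y) ∧
      ∀ x ∈ S, ∀ y ∈ S, (x ∈ J ∧ y ∈ J ∨ x ∉ J ∧ y ∉ J ∧ f x = f y) ↔
        (x ∈ K ∧ y ∈ K ∨ x ∉ K ∧ y ∉ K ∧ g x = g y) := by
  classical
  have : Fintype S := hfin.fintype
  obtain ⟨e⟩ : Nonempty (S ↪ Fin 5) := by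
    apply Function.Embedding.nonempty_of_card_le
    rwa [Fintype.card_fin, ← Nat.card_eq_fintype_card, Nat.card_coe_set_eq]
  let f' : Fin 5 → Option α := Function.extend e (fun s => some (f s)) fun _ => none
  let g' : Fin 5 → Option β := Function.extend e (fun s => some (g s)) fun _ => none
  have hf' (s : S) : f' (e s) = some (f s) := e.injective.extend_apply _ _ _
  have hg' (s : S) : g' (e s) = some (g s) := e.injective.extend_apply _ _ _
  obtain ⟨p, hp, hp5, hpf⟩ := FivePoints.exists_of_forallRep FivePoints.forallRep_recolorSearch f'
  obtain ⟨q, hq, hq5, hqg⟩ := FivePoints.exists_of_forallRep hp g'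
  obtain ⟨J, K, hJ, hK, hJK⟩ := FivePoints.exists_of_recolorSearch hq
  have hmono (L : Fin 5 → Bool)
      (hL : (FivePoints.inClass p L || FivePoints.inClass q L) = true) :
      (∀ x ∈ {x | ∃ h : x ∈ S, L (e ⟨x, h⟩) = true}, ∀ y ∈ {x | ∃ h : x ∈ S, L (e ⟨x, h⟩) = true},
        f x = f y) ∨
      ∀ x ∈ {x | ∃ h : x ∈ S, L (e ⟨x, h⟩) = true}, ∀ y ∈ {x | ∃ h : x ∈ S, L (e ⟨x, h⟩) = true},
        g x = g y := by
    rw [Bool.or_eq_true] at hL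
    refine hL.imp ?_ ?_
    · rintro h x ⟨hx, hxL⟩ y ⟨hy, hyL⟩
      simpa [hpf, hf'] using FivePoints.eq_of_inClass h _ _ hxL hyL
    · rintro h x ⟨hx, hxL⟩ y ⟨hy, hyL⟩
      simpa [hqg, hg'] using FivePoints.eq_of_inClass h _ _ hxL hyL
  refine ⟨{x | ∃ h : x ∈ S, J (e ⟨x, h⟩) = true}, {x | ∃ h : x ∈ S, K (e ⟨x, h⟩) = true},
    fun x hx => hx.1, fun x hx => hx.1, hmono J hJ, hmono K hK, fun x hx y hy => ?_⟩
  have key := FivePoints.recolor_eq_iff hJK (e ⟨x, hx⟩) (e ⟨y, hy⟩)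
  have hpxy := hpf (e ⟨x, hx⟩) (e ⟨y, hy⟩)
  have hqxy := hqg (e ⟨x, hx⟩) (e ⟨y, hy⟩)
  have hpx := hp5 (e ⟨x, hx⟩)
  have hpy := hp5 (e ⟨y, hy⟩)
  have hqx := hq5 (e ⟨x, hx⟩)
  have hqy := hq5 (e ⟨y, hy⟩)
  simp only [hf', hg', Option.some.injEq] at hpxy hqxy
  simp only [Set.mem_ofPred_eq, hx, hy, exists_true_left, ← hpxy, ← hqxy]
  simp only [FivePoints.recolor] at key
  cases hJx : J (e ⟨x, hx⟩) <;> cases hJy : J (e ⟨y, hy⟩) <;>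
    cases hKx : K (e ⟨x, hx⟩) <;> cases hKy : K (e ⟨y, hy⟩) <;>
    simp only [hJx, hJy, hKx, hKy, cond_true, cond_false, iff_true, true_iff] at key <;>
    simp <;> omega

/-- The map `c` is a proper colouring of the subgraph of `G` induced by `A`. -/
def ProperOn {V α : Type*} (G : SimpleGraph V) (A : Set V) (c : V → α) : Prop :=
  ∀ x ∈ A, ∀ y ∈ A, G.Adj x y → c x ≠ c y

theorem ProperOn.mono {V α : Type*} {G : SimpleGraph V} {A B : Set V} {c : V → α}
    (hc : ProperOn G B c) (h : A ⊆ B) : ProperOn G A c :=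
  fun x hx y hy => hc x (h hx) y (h hy)

theorem exists_properOn_of_colorable {V : Type*} {G : SimpleGraph V} {A : Set V} {n : ℕ}
    [NeZero n] (h : (G.induce A).Colorable n) : ∃ c : V → Fin n, ProperOn G A c := by
  classical
  obtain ⟨c⟩ := h
  refine ⟨fun x => if hx : x ∈ A then c ⟨x, hx⟩ else 0, fun x hx y hy hxy => ?_⟩
  simp only [hx, hy, dif_pos]
  exact c.valid (by simpa using hxy)

theorem ProperOn.recolor {V α : Type*} {G : SimpleGraph V} {A J : Set V} {c : V → α}
    [DecidablePred (· ∈ J)] (hc : ProperOn G A c) (hJ : ∀ x ∈ J, ∀ y ∈ J, ¬ G.Adj x y) :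
    ProperOn G A fun x => if x ∈ J then none else some (c x) := by
  intro x hx y hy hxy
  by_cases hxJ : x ∈ J <;> by_cases hyJ : y ∈ J <;> simp only [hxJ, hyJ, if_true, if_false]
  · exact absurd hxy (hJ x hxJ y hyJ)
  · simp
  · simp
  · simpa using hc x hx y hy hxy

theorem colorable_of_properOn_union {V α : Type*} [Fintype α] {G : SimpleGraph V}
    {A B S : Set V} (hcover : ∀ x, x ∈ A ∨ x ∈ B ∨ x ∈ S)
    (hAB : ∀ x ∈ A, ∀ y ∈ B, ¬ G.Adj x y) {c d : V → α}
    (hc : ProperOn G (A ∪ S) c) (hd : ProperOn G (B ∪ S) d)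
    (hcd : ∀ x ∈ S, ∀ y ∈ S, c x = c y ↔ d x = d y) : G.Colorable (Fintype.card α) := by
  classical
  obtain ⟨σ, hσ⟩ : ∃ σ : α ≃ (Finset.univ : Finset α),
      ∀ a ∈ Finset.univ.filter (fun a => ∃ x ∈ S, d x = a),
        (σ a : α) = if h : ∃ x ∈ S, d x = a then c h.choose else a := by
    apply Finset.exists_equiv_extend_of_card_eq (by simp) (by simp)
    intro a ha b hb hab
    simp only [Finset.coe_filter, Finset.mem_univ, true_and, Set.mem_ofPred_eq] at ha hb
    simp only [dif_pos ha, dif_pos hb] at hab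
    rw [← ha.choose_spec.2, ← hb.choose_spec.2]
    exact (hcd _ ha.choose_spec.1 _ hb.choose_spec.1).1 hab
  have hσS {x : V} (hx : x ∈ S) : (σ (d x) : α) = c x := by
    have h : ∃ y ∈ S, d y = d x := ⟨x, hx, rfl⟩
    rw [hσ _ (by simpa using h), dif_pos h]
    exact (hcd _ h.choose_spec.1 _ hx).2 h.choose_spec.2
  have hd' : ProperOn G (B ∪ S) fun x => (σ (d x) : α) := fun x hx y hy hxy h =>
    hd x hx y hy hxy (σ.injective (Subtype.ext h))
  let φ : V → α := fun x => if x ∈ A ∪ S then c x else σ (d x)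
  have hφB {x : V} (hx : x ∈ B) (hA : x ∉ A) : φ x = σ (d x) := by
    by_cases hxS : x ∈ S
    · simp [φ, hxS, hσS]
    · simp [φ, hxS, hA]
  have hφA {x : V} (hx : x ∈ A ∪ S) : φ x = c x := if_pos hx
  have hφS {x : V} (hx : x ∈ S) : φ x = σ (d x) := by rw [hφA (Or.inr hx), hσS hx]
  have hcase (x : V) : x ∈ A ∪ S ∨ x ∈ B ∧ x ∉ A := by
    have := hcover x
    simp only [Set.mem_union]
    tauto
  refine Coloring.colorable (α := α) (Coloring.mk φ fun {x y} hxy => ?_)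
  rcases hcase x with hx | ⟨hx, hxA⟩ <;> rcases hcase y with hy | ⟨hy, hyA⟩
  · rw [hφA hx, hφA hy]
    exact hc x hx y hy hxy
  · rcases hx with hx | hx
    · exact absurd hxy (hAB x hx y hy)
    · rw [hφS hx, hφB hy hyA]
      exact hd' x (Or.inr hx) y (Or.inl hy) hxy
  · rcases hy with hy | hy
    · exact absurd hxy.symm (hAB y hy x hx)
    · rw [hφB hx hxA, hφS hy]
      exact hd' x (Or.inl hx) y (Or.inr hy) hxy
  · rw [hφB hx hxA, hφB hy hyA]
    exact hd' x (Or.inl hx) y (Or.inl hy) hxy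

theorem exists_adj_of_properOn_compl {V α : Type*} [Fintype α] {G : SimpleGraph V}
    (hG : ¬ G.Colorable (Fintype.card α)) {v : V} {c : V → α} (hc : ProperOn G {v}ᶜ c) (a : α) :
    ∃ w, G.Adj v w ∧ c w = a := by
  classical
  by_contra! h
  refine hG (Coloring.colorable (α := α)
    (Coloring.mk (fun x => if x = v then a else c x) fun {x y} hxy => ?_))
  by_cases hx : x = v <;> by_cases hy : y = v <;> simp only [hx, hy, if_true, if_false]
  · exact absurd hxy (by simp [hx, hy])
  · exact (h y (hx ▸ hxy)).symm
  · exact h x (hy ▸ hxy.symm)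
  · exact hc x hx y hy hxy

/-- If the neighbourhood of `v` is confined to a set with at most as many elements as there are
colours, then it is the whole set, and its elements receive distinct colours. -/
theorem neighbors_eq_and_injOn {V α : Type*} [Fintype α] {G : SimpleGraph V}
    (hG : ¬ G.Colorable (Fintype.card α)) {v : V} {c : V → α} (hc : ProperOn G {v}ᶜ c)
    {S : Set V} (hfin : S.Finite) (hS : S.ncard ≤ Fintype.card α) (hv : ∀ w, G.Adj v w → w ∈ S) :
    S.ncard = Fintype.card α ∧ (∀ s ∈ S, G.Adj v s) ∧ Set.InjOn c S := by
  classical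
  choose w hw hcw using exists_adj_of_properOn_compl hG hc
  have hinj : Function.Injective w := fun a b h => by rw [← hcw a, ← hcw b, h]
  have hrange : Set.range w = S := by
    apply Set.eq_of_subset_of_ncard_le _ _ hfin
    · rintro _ ⟨a, rfl⟩
      exact hv _ (hw a)
    · rwa [← Nat.card_coe_set_eq (Set.range w), Nat.card_range_of_injective hinj,
        Nat.card_eq_fintype_card]
  subst hrange
  refine ⟨?_, ?_, ?_⟩
  · rw [← Nat.card_coe_set_eq, Nat.card_range_of_injective hinj, Nat.card_eq_fintype_card]
  · rintro _ ⟨a, rfl⟩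
    exact hw a
  · rintro _ ⟨a, rfl⟩ _ ⟨b, rfl⟩ h
    rw [hcw, hcw] at h
    rw [h]

theorem exists_adj_of_separates {V : Type*} [Finite V] {G : SimpleGraph V} {m : ℕ} (hm : 4 ≤ m)
    (hG : ¬ G.Colorable (m + 1))
    (hvertex : ∀ v, ∃ c : V → Fin (m + 1), ProperOn G {v}ᶜ c)
    (hedge : ∀ x y, G.Adj x y → ∃ c : V → Fin m, ProperOn G {x, y}ᶜ c)
    {A B S : Set V} (hA : A.Nonempty) (hB : B.Nonempty) (hcover : ∀ x, x ∈ A ∨ x ∈ B ∨ x ∈ S)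
    (hAS : Disjoint A S) (hBS : Disjoint B S) (hABdisj : Disjoint A B)
    (hAB : ∀ x ∈ A, ∀ y ∈ B, ¬ G.Adj x y) (hS : S.ncard ≤ 5) :
    ∃ x ∈ B, ∃ y ∈ B, G.Adj x y := by
  classical
  by_contra! hind
  obtain ⟨u, hu⟩ := hA
  obtain ⟨v, hv⟩ := hB
  have hvS : v ∉ S := hBS.notMem_of_mem_left hv
  have hN (w : V) (hw : G.Adj v w) : w ∈ S := by
    rcases hcover w with h | h | h
    · exact absurd hw.symm (hAB w h v hv)
    · exact absurd hw (hind v hv w h)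
    · exact h
  obtain ⟨c, hc⟩ := hvertex v
  obtain ⟨hcard, hadj, -⟩ := neighbors_eq_and_injOn (by simpa using hG) hc S.toFinite
    (by rw [Fintype.card_fin]; omega) hN
  rw [Fintype.card_fin] at hcard
  have hclique : ∀ s ∈ S, ∀ t ∈ S, s ≠ t → G.Adj s t := by
    intro s hs t ht hst
    by_contra hnadj
    obtain ⟨d, hd⟩ := hedge v s (hadj s hs)
    have hd' : ProperOn G {v}ᶜ fun x => if x ∈ ({s, t} : Set V) then none else some (d x) := by
      intro x hx y hy hxy
      by_cases hxJ : x ∈ ({s, t} : Set V) <;> by_cases hyJ : y ∈ ({s, t} : Set V) <;>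
        simp only [hxJ, hyJ, if_true, if_false]
      · exfalso
        rcases hxJ with rfl | rfl <;> rcases hyJ with rfl | rfl
        · exact G.irrefl hxy
        · exact hnadj hxy
        · exact hnadj hxy.symm
        · exact G.irrefl hxy
      · simp
      · simp
      · have hx' : x ∈ ({v, s} : Set V)ᶜ := by
          simp only [Set.mem_compl_iff, Set.mem_insert_iff, Set.mem_singleton_iff] at *
          tauto
        have hy' : y ∈ ({v, s} : Set V)ᶜ := by
          simp only [Set.mem_compl_iff, Set.mem_insert_iff, Set.mem_singleton_iff] at *
          tauto
        simpa using hd x hx' y hy' hxy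
    obtain ⟨-, -, hinj⟩ := neighbors_eq_and_injOn (by simpa using hG) hd' S.toFinite
      (by simp [hcard]) hN
    exact hst (hinj hs ht (by simp))
  obtain ⟨d, hd⟩ := hvertex u
  have huS : u ∉ S := hAS.notMem_of_mem_left hu
  have huv : v ≠ u := fun h => hABdisj.notMem_of_mem_left hu (h ▸ hv)
  have hinj : Set.InjOn d (insert v S) := by
    intro x hx y hy hxy
    by_contra hne
    have hmem {z : V} (hz : z ∈ insert v S) : z ∈ ({u} : Set V)ᶜ := by
      rintro rfl
      rcases hz with h | h
      · exact huv h.symm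
      · exact huS h
    refine hd x (hmem hx) y (hmem hy) ?_ hxy
    rcases hx with rfl | hx <;> rcases hy with rfl | hy
    · exact absurd rfl hne
    · exact hadj y hy
    · exact (hadj x hx).symm
    · exact hclique x hx y hy hne
  have hle := Set.ncard_le_ncard (Set.subset_univ (d '' insert v S))
  rw [hinj.ncard_image, Set.ncard_insert_of_notMem hvS, Set.ncard_univ, Nat.card_eq_fintype_card,
    Fintype.card_fin, hcard] at hle
  omega

theorem not_separates {V : Type*} [Finite V] {G : SimpleGraph V} {m : ℕ} (hm : 4 ≤ m)
    (hG : ¬ G.Colorable (m + 1))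
    (hvertex : ∀ v, ∃ c : V → Fin (m + 1), ProperOn G {v}ᶜ c)
    (hedge : ∀ x y, G.Adj x y → ∃ c : V → Fin m, ProperOn G {x, y}ᶜ c)
    {A B S : Set V} (hA : A.Nonempty) (hB : B.Nonempty) (hcover : ∀ x, x ∈ A ∨ x ∈ B ∨ x ∈ S)
    (hAS : Disjoint A S) (hBS : Disjoint B S) (hABdisj : Disjoint A B)
    (hAB : ∀ x ∈ A, ∀ y ∈ B, ¬ G.Adj x y) : 5 < S.ncard := by
  classical
  by_contra! hS
  obtain ⟨x, hx, y, hy, hxy⟩ :=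
    exists_adj_of_separates hm hG hvertex hedge hA hB hcover hAS hBS hABdisj hAB hS
  obtain ⟨x', hx', y', hy', hxy'⟩ :=
    exists_adj_of_separates (A := B) (B := A) hm hG hvertex hedge hB hA
      (fun z => or_left_comm.1 (hcover z)) hBS hAS hABdisj.symm
      (fun z hz w hw h => hAB w hw z hz h.symm) hS
  obtain ⟨c, hc⟩ := hedge x y hxy
  obtain ⟨d, hd⟩ := hedge x' y' hxy'
  have hcA : ProperOn G (A ∪ S) c := by
    apply hc.mono
    rintro z hz (rfl | rfl)
    · exact hz.elim (hABdisj.notMem_of_mem_right hx) (hBS.notMem_of_mem_left hx)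
    · exact hz.elim (hABdisj.notMem_of_mem_right hy) (hBS.notMem_of_mem_left hy)
  have hdB : ProperOn G (B ∪ S) d := by
    apply hd.mono
    rintro z hz (rfl | rfl)
    · exact hz.elim (hABdisj.notMem_of_mem_left hx') (hAS.notMem_of_mem_left hx')
    · exact hz.elim (hABdisj.notMem_of_mem_left hy') (hAS.notMem_of_mem_left hy')
  obtain ⟨J, K, hJS, hKS, hJ, hK, hJK⟩ := exists_common_recoloring S S.toFinite hS c d
  have hind {L : Set V} (hLS : L ⊆ S)
      (hL : (∀ x ∈ L, ∀ y ∈ L, c x = c y) ∨ ∀ x ∈ L, ∀ y ∈ L, d x = d y) :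
      ∀ x ∈ L, ∀ y ∈ L, ¬ G.Adj x y := by
    intro x hx y hy hxy
    rcases hL with hL | hL
    · exact hcA x (Or.inr (hLS hx)) y (Or.inr (hLS hy)) hxy (hL x hx y hy)
    · exact hdB x (Or.inr (hLS hx)) y (Or.inr (hLS hy)) hxy (hL x hx y hy)
  refine hG ?_
  have := colorable_of_properOn_union hcover hAB (hcA.recolor (hind hJS hJ))
    (hdB.recolor (hind hKS hK)) fun x hx y hy => ?_
  · simpa using this
  · have := hJK x hx y hy
    by_cases h1 : x ∈ J <;> by_cases h2 : y ∈ J <;> by_cases h3 : x ∈ K <;>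
      by_cases h4 : y ∈ K <;> simp_all

theorem eq_top_of_card_le {V : Type*} [Fintype V] {G : SimpleGraph V} {n : ℕ}
    (hG : ¬ G.Colorable n) (hn : Fintype.card V ≤ n + 1) : G = ⊤ := by
  classical
  by_contra hne
  obtain ⟨x, y, hxy, hadj⟩ : ∃ x y, x ≠ y ∧ ¬ G.Adj x y := by
    by_contra! h
    exact hne (SimpleGraph.ext (by ext x y; exact ⟨fun h => h.ne, h x y⟩))
  refine hG (Colorable.mono (n := Fintype.card {z // z ≠ y}) ?_
    (Coloring.colorable (α := {z // z ≠ y})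
      (Coloring.mk (fun z => if h : z = y then ⟨x, hxy⟩ else ⟨z, h⟩) fun {z w} hzw => ?_)))
  · rw [Fintype.card_subtype_compl, Fintype.card_subtype_eq]
    omega
  · by_cases hz : z = y <;> by_cases hw : w = y <;> simp only [hz, hw, dif_pos, dif_neg,
      not_false_eq_true, ne_eq, Subtype.mk.injEq]
    · exact absurd hzw (by simp [hz, hw])
    · rintro rfl
      exact hadj (hz ▸ hzw.symm)
    · rintro rfl
      exact hadj (hw ▸ hzw)
    · exact hzw.ne

/-- Every non-complete double-critical `k`-chromatic graph with `k ≥ 6` is `6`-connected: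
it has more than `6` vertices, and deleting fewer than `6` vertices leaves a connected graph. -/
theorem stmt15 {V : Type} [Fintype V] (G : SimpleGraph V) (k : ℕ) (hk : 6 ≤ k)
    (hnc : G ≠ ⊤) (hdc : DoubleCritical G) (hchrom : G.chromaticNumber = k) :
    6 < Fintype.card V ∧
    ∀ S : Set V, S.ncard < 6 → (G.induce Sᶜ).Connected := by
  obtain ⟨m, rfl⟩ : ∃ m, k = m + 2 := ⟨k - 2, by omega⟩
  have : NeZero m := ⟨by omega⟩
  have hG : ¬ G.Colorable (m + 1) := by
    rw [← chromaticNumber_le_iff_colorable, hchrom, Nat.cast_le]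
    omega
  have hvertex (v : V) : ∃ c : V → Fin (m + 1), ProperOn G {v}ᶜ c := by
    apply exists_properOn_of_colorable
    rw [← chromaticNumber_le_iff_colorable]
    have h := hdc.1 v
    rw [hchrom] at h
    exact ENat.lt_natCast_add_one_iff.1 (by exact_mod_cast h)
  have hedge (x y : V) (hxy : G.Adj x y) : ∃ c : V → Fin m, ProperOn G {x, y}ᶜ c := by
    apply exists_properOn_of_colorable
    rw [← chromaticNumber_le_iff_colorable]
    have h := hdc.2 x y hxy
    rw [hchrom, Nat.cast_add] at h
    exact (ENat.add_le_add_iff_right (by simp)).1 h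
  have hcard : 6 < Fintype.card V := by
    by_contra! h
    exact hnc (eq_top_of_card_le hG (by omega))
  refine ⟨hcard, fun S hS => ?_⟩
  obtain ⟨u, hu⟩ : ∃ u, u ∉ S := by
    by_contra! h
    rw [Set.eq_univ_of_forall h, Set.ncard_univ, Nat.card_eq_fintype_card] at hS
    omega
  have : Nonempty (Sᶜ : Set V) := ⟨⟨u, hu⟩⟩
  refine ⟨fun a b => ?_⟩
  by_contra hab
  have := not_separates (S := S) (A := {x | ∃ h : x ∈ Sᶜ, (G.induce Sᶜ).Reachable a ⟨x, h⟩})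
    (B := {x | ∃ h : x ∈ Sᶜ, ¬ (G.induce Sᶜ).Reachable a ⟨x, h⟩}) (by omega) hG hvertex hedge
    ⟨a, a.2, Reachable.refl _⟩ ⟨b, b.2, hab⟩
    (fun x => by
      by_cases hx : x ∈ S
      · exact Or.inr (Or.inr hx)
      · by_cases h : (G.induce Sᶜ).Reachable a ⟨x, hx⟩
        · exact Or.inl ⟨hx, h⟩
        · exact Or.inr (Or.inl ⟨hx, h⟩))
    (Set.disjoint_left.2 fun x hx => hx.1) (Set.disjoint_left.2 fun x hx => hx.1)
    (Set.disjoint_left.2 fun x hx hx' => hx'.2 hx.2)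
    (by
      rintro x ⟨hx, hxr⟩ y ⟨hy, hyr⟩ hxy
      exact hyr (hxr.trans (Adj.reachable (by simpa using hxy))))
  omega
end

section
/- Every double-critical 6-chromatic graph contains K₆ as a minor. -/
open SimpleGraph

/-- `G` contains the complete graph `K_m` as a minor: there are `m` pairwise disjoint
non-empty subsets of the vertex set, each inducing a connected subgraph of `G`, with at
least one edge of `G` between every two of the subsets. -/
def HasCompleteMinor {V : Type} (G : SimpleGraph V) (m : ℕ) : Prop :=
  ∃ f : Fin m → Set V,
    (∀ i, (f i).Nonempty) ∧
    (∀ i, (G.induce (f i)).Connected) ∧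
    (∀ i j, i ≠ j → Disjoint (f i) (f j)) ∧
    (∀ i j, i ≠ j → ∃ u ∈ f i, ∃ v ∈ f j, G.Adj u v)

namespace NonEdgeSearch

/-! The graphs on at most seven vertices with minimum degree at least four are analysed by a
search over their complements.  A complement on the vertices `0, …, 6` is stored as a natural
number whose binary digits mark the non-edges.  The functions that the kernel has to evaluate are
written with recursors, which keeps this evaluation short. -/

/-- The binary digit that records the pair `{i, j}`. -/
def idx (i j : ℕ) : ℕ := bif Nat.blt i j then Nat.add (Nat.mul 7 i) j else Nat.add (Nat.mul 7 j) i

/-- The number in which only the digit of the pair `{i, j}` is set. -/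
def digit (i j : ℕ) : ℕ := Nat.pow 2 (idx i j)

/-- `List.any`, by the recursor. -/
noncomputable def anyR {α : Type} (p : α → Bool) (l : List α) : Bool :=
  List.rec false (fun a _ ih => Bool.rec ih true (p a)) l

/-- `List.all`, by the recursor. -/
noncomputable def allR {α : Type} (p : α → Bool) (l : List α) : Bool :=
  List.rec true (fun a _ ih => Bool.rec false ih (p a)) l

/-- Boolean disjunction, by the recursor. -/
noncomputable def orR (a b : Bool) : Bool := Bool.rec b true a

/-- Boolean conjunction, by the recursor. -/
noncomputable def andR (a b : Bool) : Bool := Bool.rec false b a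

/-- Whether some digit of `k` is not a digit of `m`. -/
noncomputable def misses (m k : ℕ) : Bool := Bool.rec true false (Nat.beq (Nat.land m k) k)

/-- The ways to split a list into blocks of which `k` have two elements and the others one; the
first argument bounds the depth of the recursion. -/
def mergings : ℕ → ℕ → List ℕ → List (List (List ℕ))
  | 0, _, _ => [[]]
  | _ + 1, _, [] => [[]]
  | f + 1, k, a :: l =>
    (bif Nat.blt 0 k then
      l.flatMap fun b => (mergings f (k - 1) (l.erase b)).map ([a, b] :: ·) else []) ++
    (bif Nat.ble k (l.length / 2) then (mergings f k l).map ([a] :: ·) else [])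

/-- The pairs between two lists of vertices. -/
def mask (A B : List ℕ) : ℕ := A.foldr (fun a s => B.foldr (fun b t => Nat.lor (digit a b) t) s) 0

/-- The sets of pairs which a graph has to meet in order to contain a complete minor with the given
blocks. -/
def masks : List (List ℕ) → List ℕ
  | [] => []
  | A :: l => (match A with | [a, b] => [digit a b] | _ => []) ++ l.map (mask A) ++ masks l

/-- The partitions of `0, …, n - 1` into five blocks with at most two elements each. -/
def partitions (n : ℕ) : List (List (List ℕ)) := mergings n (n - 5) (List.range n)

/-- Whether the complement of `m` has a complete minor on one of the partitions. -/
noncomputable def hasModel (n m : ℕ) : Bool :=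
  anyR (allR (misses m)) ((partitions n).map masks)

/-- The pairs that contain `i`. -/
def star (n i : ℕ) : ℕ :=
  (List.range n).foldr (fun j s => bif Nat.beq i j then s else Nat.lor (digit i j) s) 0

/-- Erase the lowest digit `k` times. -/
noncomputable def clears (k r : ℕ) : ℕ :=
  Nat.rec (fun r => r) (fun _ f r => f (Nat.land r (Nat.pred r))) k r

/-- Whether more than `k` of the pairs in `m` contain `i`. -/
noncomputable def crowded (n k m i : ℕ) : Bool :=
  Nat.ble 1 (clears k (Nat.land m (star n i)))

/-- The pairs of vertices below `n`. -/
def pairs (n : ℕ) : List (ℕ × ℕ) :=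
  (List.range n).flatMap fun i => ((List.range n).filter (Nat.blt i)).map fun j => (i, j)

/-- The pairs of vertices below `n` which may be non-edges for a well chosen labelling. -/
def freePairs (n : ℕ) : List (ℕ × ℕ) :=
  (pairs n).filter fun p =>
    !(Nat.beq p.1 0 && Nat.ble 3 p.2) && !(Nat.beq p.1 1 && Nat.ble 5 p.2)

/-- The digit sets of the complete graphs on four vertices below `n`. -/
def quads (n : ℕ) : List ℕ :=
  (pairs n).flatMap fun p => ((pairs n).filter fun q => Nat.blt p.2 q.1).map fun q =>
    Nat.lor (digit p.1 p.2) (Nat.lor (digit q.1 q.2) (mask [p.1, p.2] [q.1, q.2]))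

/-- The properties of the two graphs without a complete minor on five vertices. -/
noncomputable def exceptional (n m : ℕ) : Bool :=
  andR (anyR (crowded n (n - 6) m) (List.range n)) <|
  andR (allR (fun p => orR (misses m (digit p.1 p.2))
    (hasModel n (Nat.xor m (digit p.1 p.2)))) (pairs n)) <|
  andR (anyR (fun p => andR (!misses m (digit p.1 p.2))
    (allR (fun k => orR (orR (Nat.beq p.1 k) (Nat.beq p.2 k))
      (orR (misses m (digit p.2 k)) (!misses m (digit p.1 k)))) (List.range n))) (pairs n)) <|
  allR (fun k => !Nat.beq (Nat.land m k) 0) (quads n)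

/-- Search through all sets of pairs from a list in which no vertex is crowded. -/
noncomputable def search (n : ℕ) (l : List (ℕ × ℕ)) : ℕ → Bool :=
  List.rec (fun m => orR (anyR (crowded n (n - 5) m) [n - 1, n - 2])
      (orR (hasModel n m) (exceptional n m)))
    (fun p _ ih m => orR (andR (Nat.beq p.2 (p.1 + 1)) (crowded n (n - 5) m (p.1 - 1)))
      (andR (ih m) (ih (Nat.lor m (digit p.1 p.2))))) l

theorem search_five : search 5 (freePairs 5) 0 = true := by decide +kernel

theorem search_six : search 6 (freePairs 6) 0 = true := by decide +kernel

theorem search_seven : search 7 (freePairs 7) 0 = true := by decide +kernel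

theorem search_freePairs {n : ℕ} (h5 : 5 ≤ n) (h7 : n ≤ 7) : search n (freePairs n) 0 = true := by
  interval_cases n
  exacts [search_five, search_six, search_seven]

theorem anyR_eq {α : Type} (p : α → Bool) (l : List α) : anyR p l = l.any p := by
  induction l with
  | nil => rfl
  | cons a l ih => rw [List.any_cons, ← ih]; cases h : p a <;> simp [anyR, h]

theorem allR_eq {α : Type} (p : α → Bool) (l : List α) : allR p l = l.all p := by
  induction l with
  | nil => rfl
  | cons a l ih => rw [List.all_cons, ← ih]; cases h : p a <;> simp [allR, h]

theorem orR_eq (a b : Bool) : orR a b = (a || b) := by cases a <;> rfl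

theorem andR_eq (a b : Bool) : andR a b = (a && b) := by cases a <;> rfl

theorem idx_comm (i j : ℕ) : idx i j = idx j i := by
  rcases lt_trichotomy i j with h | rfl | h
  · simp [idx, Nat.blt_eq, h, h.not_gt, cond_eq_ite]
  · rfl
  · simp [idx, Nat.blt_eq, h, h.not_gt, cond_eq_ite]

theorem idx_of_lt {i j : ℕ} (h : i < j) : idx i j = 7 * i + j := by
  simp [idx, Nat.blt_eq, h, cond_eq_ite]

theorem testBit_digit (i j t : ℕ) : (digit i j).testBit t = decide (idx i j = t) :=
  Nat.testBit_two_pow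

theorem misses_eq_true {m k : ℕ} :
    misses m k = true ↔ ∃ t, k.testBit t = true ∧ m.testBit t = false := by
  have h : misses m k = !(Nat.beq (m &&& k) k) := by
    unfold misses
    rw [show Nat.land m k = m &&& k from rfl]
    cases Nat.beq (m &&& k) k <;> rfl
  rw [h, Bool.not_eq_true', ← Bool.not_eq_true, Nat.beq_eq]
  constructor
  · intro hne
    obtain ⟨t, ht⟩ := Nat.exists_testBit_ne_of_ne hne
    refine ⟨t, ?_⟩
    rw [Nat.testBit_and] at ht
    cases h1 : m.testBit t <;> cases h2 : k.testBit t <;> simp_all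
  · rintro ⟨t, h1, h2⟩ he
    have := congrArg (fun n => n.testBit t) he
    simp [h1, h2] at this

theorem misses_digit {m i j : ℕ} : misses m (digit i j) = true ↔ m.testBit (idx i j) = false := by
  rw [misses_eq_true]
  simp [testBit_digit]

theorem testBit_mask {A B : List ℕ} {t : ℕ} :
    (mask A B).testBit t = true ↔ ∃ a ∈ A, ∃ b ∈ B, idx a b = t := by
  have inner (a s : ℕ) : (B.foldr (fun b t => Nat.lor (digit a b) t) s).testBit t = true ↔
      (∃ b ∈ B, idx a b = t) ∨ s.testBit t = true := by
    induction B with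
    | nil => simp
    | cons b B ih =>
      change (digit a b ||| _).testBit t = true ↔ _
      rw [Nat.testBit_or, Bool.or_eq_true, ih, testBit_digit]
      simp [or_assoc]
  induction A with
  | nil => simp [mask]
  | cons a A ih =>
    change (B.foldr (fun b t => Nat.lor (digit a b) t) (mask A B)).testBit t = true ↔ _
    refine (inner a _).trans ((or_congr_right ih).trans ?_)
    simp

theorem testBit_star {n i t : ℕ} :
    (star n i).testBit t = true ↔ ∃ j < n, j ≠ i ∧ idx i j = t := by
  have aux (l : List ℕ) :
      (l.foldr (fun j s => bif Nat.beq i j then s else Nat.lor (digit i j) s) 0).testBit t = true ↔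
        ∃ j ∈ l, j ≠ i ∧ idx i j = t := by
    induction l with
    | nil => simp
    | cons j l ih =>
      rw [List.foldr_cons]
      by_cases h : i = j
      · subst h
        rw [show Nat.beq i i = true by simp, cond_true, ih]
        simp
      · have hb : Nat.beq i j = false := by
          rw [← Bool.not_eq_true, Nat.beq_eq]; exact h
        rw [hb, cond_false]
        change (digit i j ||| _).testBit t = true ↔ _
        rw [Nat.testBit_or, Bool.or_eq_true, ih, testBit_digit]
        simp [Ne.symm h]
  simpa [star] using aux (List.range n)

theorem exists_testBit_of_clears (k : ℕ) : ∀ r : ℕ, clears k r ≠ 0 →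
    ∃ S : Finset ℕ, k < S.card ∧ ∀ t ∈ S, r.testBit t = true := by
  have step (r : ℕ) (hr : r ≠ 0) : ∃ t, r.testBit t = true ∧ (r &&& r.pred).testBit t = false := by
    have hne : r &&& r.pred ≠ r := by
      have h1 : r &&& r.pred ≤ r.pred := Nat.and_le_right
      have h2 : r.pred < r := Nat.pred_lt hr
      omega
    obtain ⟨t, ht⟩ := Nat.exists_testBit_ne_of_ne hne
    refine ⟨t, ?_⟩
    rw [Nat.testBit_and] at ht ⊢
    cases h : r.testBit t <;> simp_all
  induction k with
  | zero =>
    intro r hr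
    obtain ⟨t, ht, -⟩ := step r hr
    exact ⟨{t}, by simp, by simpa using ht⟩
  | succ k ih =>
    intro r hr
    obtain ⟨S, hS, hSr⟩ := ih (r &&& r.pred) hr
    have hr0 : r ≠ 0 := by
      rintro rfl
      obtain ⟨t, ht⟩ := Finset.card_pos.1 (by omega : 0 < S.card)
      simpa using hSr t ht
    obtain ⟨t, ht, htn⟩ := step r hr0
    have htS : t ∉ S := fun h => by rw [hSr t h] at htn; cases htn
    refine ⟨insert t S, by rw [Finset.card_insert_of_notMem htS]; omega, ?_⟩
    intro u hu
    rcases Finset.mem_insert.1 hu with rfl | hu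
    · exact ht
    · have := hSr u hu
      rw [Nat.testBit_and, Bool.and_eq_true] at this
      exact this.1

theorem card_lt_of_crowded {n k m i : ℕ} (h : crowded n k m i = true) :
    k < ((Finset.range n).filter fun j => j ≠ i ∧ m.testBit (idx i j) = true).card := by
  have h1 : clears k (m &&& star n i) ≠ 0 := by
    exact Nat.one_le_iff_ne_zero.1 (Nat.le_of_ble_eq_true h)
  obtain ⟨S, hS, hSt⟩ := exists_testBit_of_clears k _ h1
  refine hS.trans_le ((Finset.card_le_card (t := Finset.image (idx i) _) ?_).trans
    Finset.card_image_le)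
  intro t ht
  have h2 := hSt t ht
  rw [Nat.testBit_and, Bool.and_eq_true, testBit_star] at h2
  obtain ⟨h3, j, hj, hji, rfl⟩ := h2
  exact Finset.mem_image.2 ⟨j, by simp [hj, hji, h3], rfl⟩

theorem exists_of_search {n : ℕ} (β : ℕ → Prop)
    (hβ : ∀ m i, i < n → (∀ t, m.testBit t = true → β t) → crowded n (n - 5) m i = false) :
    ∀ (l : List (ℕ × ℕ)) (m : ℕ), (∀ p ∈ l, p.1 < n) → 0 < n → (∀ t, m.testBit t = true → β t) →
      search n l m = true →
      ∃ M, (∀ t, M.testBit t = true → β t) ∧ (∀ t, m.testBit t = true → M.testBit t = true) ∧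
        (∀ p ∈ l, β (idx p.1 p.2) → M.testBit (idx p.1 p.2) = true) ∧
        (hasModel n M = true ∨ exceptional n M = true) := by
  intro l
  induction l with
  | nil =>
    intro m _ hn hm h
    refine ⟨m, hm, fun _ => id, by simp, ?_⟩
    change orR (anyR (crowded n (n - 5) m) [n - 1, n - 2])
      (orR (hasModel n m) (exceptional n m)) = true at h
    rw [orR_eq, orR_eq, anyR_eq] at h
    simpa [hβ m (n - 1) (by omega) hm, hβ m (n - 2) (by omega) hm] using h
  | cons p l ih =>
    intro m hl hn hm h
    change orR (andR (Nat.beq p.2 (p.1 + 1)) (crowded n (n - 5) m (p.1 - 1)))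
      (andR (search n l m) (search n l (m ||| digit p.1 p.2))) = true at h
    have hp := hl p (by simp)
    rw [orR_eq, andR_eq, andR_eq, hβ m (p.1 - 1) (by omega) hm] at h
    simp only [Bool.and_false, Bool.false_or, Bool.and_eq_true] at h
    have hl' : ∀ p ∈ l, p.1 < n := fun q hq => hl q (by simp [hq])
    by_cases hb : β (idx p.1 p.2)
    · obtain ⟨M, h1, h2, h3, h4⟩ := ih (m ||| digit p.1 p.2) hl' hn (by
        intro t ht
        rw [Nat.testBit_or, Bool.or_eq_true, testBit_digit, decide_eq_true_eq] at ht
        rcases ht with ht | rfl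
        exacts [hm t ht, hb]) h.2
      simp only [Nat.testBit_or, Bool.or_eq_true, testBit_digit, decide_eq_true_eq] at h2
      refine ⟨M, h1, fun t ht => h2 t (Or.inl ht), ?_, h4⟩
      intro q hq hqb
      rcases List.mem_cons.1 hq with rfl | hq
      exacts [h2 _ (Or.inr rfl), h3 q hq hqb]
    · obtain ⟨M, h1, h2, h3, h4⟩ := ih m hl' hn hm h.1
      refine ⟨M, h1, h2, ?_, h4⟩
      intro q hq hqb
      rcases List.mem_cons.1 hq with rfl | hq
      exacts [absurd hqb hb, h3 q hq hqb]

/-- A partition into five blocks with at most two elements each. -/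
def Valid (n : ℕ) (P : List (List ℕ)) : Prop :=
  P.length = 5 ∧ P.flatten.Nodup ∧ (∀ A ∈ P, A.length = 1 ∨ A.length = 2) ∧
    ∀ A ∈ P, ∀ a ∈ A, a < n

instance (n : ℕ) (P : List (List ℕ)) : Decidable (Valid n P) := by
  unfold Valid
  infer_instance

theorem valid_of_mem_partitions {n : ℕ} (h5 : 5 ≤ n) (h7 : n ≤ 7) :
    ∀ P ∈ partitions n, Valid n P := by
  interval_cases n <;> decide +kernel

theorem exists_partition_of_hasModel {n m : ℕ} (h : hasModel n m = true) :
    ∃ P ∈ partitions n,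
      (∀ a b, [a, b] ∈ P → m.testBit (idx a b) = false) ∧
      P.Pairwise fun A B => ∃ a ∈ A, ∃ b ∈ B, m.testBit (idx a b) = false := by
  rw [hasModel, anyR_eq, List.any_eq_true] at h
  obtain ⟨_, hP', h⟩ := h
  obtain ⟨P, hP, rfl⟩ := List.mem_map.1 hP'
  rw [allR_eq] at h
  refine ⟨P, hP, ?_⟩
  clear hP hP'
  induction P with
  | nil => simp
  | cons A P ih =>
    simp only [masks, List.all_append, Bool.and_eq_true, List.all_map] at h
    obtain ⟨ih1, ih2⟩ := ih h.2
    constructor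
    · intro a b hab
      rcases List.mem_cons.1 hab with rfl | hab
      · simpa [misses_digit] using h.1.1
      · exact ih1 a b hab
    · refine List.pairwise_cons.2 ⟨fun B hB => ?_, ih2⟩
      have := (List.all_eq_true.1 h.1.2) B hB
      obtain ⟨t, ht, htm⟩ := misses_eq_true.1 this
      obtain ⟨a, ha, b, hb, rfl⟩ := testBit_mask.1 ht
      exact ⟨a, ha, b, hb, htm⟩

theorem mem_pairs {n : ℕ} {p : ℕ × ℕ} : p ∈ pairs n ↔ p.1 < p.2 ∧ p.2 < n := by
  obtain ⟨i, j⟩ := p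
  simp only [pairs, List.mem_flatMap, List.mem_range, List.mem_map, List.mem_filter, Prod.mk.injEq,
    Nat.blt_eq]
  constructor
  · rintro ⟨a, ha, b, ⟨hb, hab⟩, rfl, rfl⟩
    exact ⟨hab, hb⟩
  · rintro ⟨h1, h2⟩
    exact ⟨i, by omega, j, ⟨h2, h1⟩, rfl, rfl⟩

theorem mem_freePairs {n : ℕ} {p : ℕ × ℕ} (hp : p ∈ pairs n) (h0 : p.1 = 0 → p.2 < 3)
    (h1 : p.1 = 1 → p.2 < 5) : p ∈ freePairs n := by
  refine List.mem_filter.2 ⟨hp, ?_⟩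
  simp only [Bool.and_eq_true, Bool.not_eq_true', ← Bool.not_eq_true,
    Nat.beq_eq, Nat.ble_eq]
  omega

end NonEdgeSearch

section Minors

variable {V W : Type} {G : SimpleGraph V}

theorem HasCompleteMinor.mono {G' : SimpleGraph V} {m : ℕ} (hG : G ≤ G')
    (h : HasCompleteMinor G m) : HasCompleteMinor G' m := by
  obtain ⟨f, h1, h2, h3, h4⟩ := h
  refine ⟨f, h1, fun i => (h2 i).mono fun _ _ h => hG h, h3, fun i j hij => ?_⟩
  obtain ⟨u, hu, v, hv, huv⟩ := h4 i j hij
  exact ⟨u, hu, v, hv, hG huv⟩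

theorem reachable_preimage {r : V → W} (hr : ∀ w, (G.induce (r ⁻¹' {w})).Preconnected) {T : Set W}
    {w w' : T} (p : ((G.map r).induce T).Walk w w') :
    ∀ (a b : r ⁻¹' T), r a = w → r b = w' → (G.induce (r ⁻¹' T)).Reachable a b := by
  have fibre (w : T) (a b : r ⁻¹' T) (ha : r a = w) (hb : r b = w) :
      (G.induce (r ⁻¹' T)).Reachable a b :=
    (hr w ⟨a, ha⟩ ⟨b, hb⟩).map (G.induceHomOfLE (s := r ⁻¹' {w.1}) (s' := r ⁻¹' T) (by
      intro v hv
      rw [Set.mem_preimage, show r v = w from hv]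
      exact w.2)).toHom
  induction p with
  | nil => exact fibre _
  | cons h p ih =>
    rename_i u v w
    intro a b ha hb
    obtain ⟨-, c, d, hcd, hc, hd⟩ := h
    have hcT : c ∈ r ⁻¹' T := by
      change r c ∈ T
      rw [hc]
      exact u.2
    have hdT : d ∈ r ⁻¹' T := by
      change r d ∈ T
      rw [hd]
      exact v.2
    have hadj : (G.induce (r ⁻¹' T)).Adj ⟨c, hcT⟩ ⟨d, hdT⟩ := hcd
    exact ((fibre u a ⟨c, hcT⟩ ha hc).trans hadj.reachable).trans (ih ⟨d, hdT⟩ b hd hb)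

theorem HasCompleteMinor.of_map {r : V → W} (hr : ∀ w, (G.induce (r ⁻¹' {w})).Preconnected)
    {m : ℕ} (hm : 2 ≤ m) (h : HasCompleteMinor (G.map r) m) : HasCompleteMinor G m := by
  obtain ⟨f, -, h2, h3, h4⟩ := h
  have adj (i j : Fin m) (hij : i ≠ j) :
      ∃ u ∈ r ⁻¹' f i, ∃ v ∈ r ⁻¹' f j, G.Adj u v := by
    obtain ⟨_, hu, _, hv, -, a, b, hab, rfl, rfl⟩ := h4 i j hij
    exact ⟨a, hu, b, hv, hab⟩
  have ne (i : Fin m) : (r ⁻¹' f i).Nonempty := by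
    obtain ⟨j, hj⟩ : ∃ j : Fin m, i ≠ j := by
      by_cases hi : i = ⟨0, by omega⟩
      · exact ⟨⟨1, by omega⟩, by simp [hi]⟩
      · exact ⟨_, hi⟩
    obtain ⟨a, ha, -⟩ := adj i j hj
    exact ⟨a, ha⟩
  refine ⟨fun i => r ⁻¹' f i, ne, fun i => ?_, fun i j hij => (h3 i j hij).preimage r, adj⟩
  have := (ne i).to_subtype
  refine ⟨fun a b => ?_⟩
  obtain ⟨p⟩ := (h2 i).preconnected ⟨r a, a.2⟩ ⟨r b, b.2⟩
  exact reachable_preimage hr p a b rfl rfl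

open Classical in
/-- The map that contracts a set to one of its vertices. -/
noncomputable def contraction (S : Set V) (x : V) (v : V) : V := if v ∈ S then x else v

theorem contraction_of_mem {S : Set V} {x v : V} (hv : v ∈ S) : contraction S x v = x := if_pos hv

theorem contraction_of_notMem {S : Set V} {x v : V} (hv : v ∉ S) : contraction S x v = v :=
  if_neg hv

theorem HasCompleteMinor.of_contraction {S : Set V} {x : V} (hx : x ∈ S)
    (hS : (G.induce S).Preconnected) {m : ℕ} (hm : 2 ≤ m)
    (h : HasCompleteMinor (G.map (contraction S x)) m) : HasCompleteMinor G m := by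
  refine h.of_map (fun w => ?_) hm
  by_cases hw : w = x
  · have : contraction S x ⁻¹' {w} = S := by
      ext v
      by_cases hv : v ∈ S
      · simp [contraction_of_mem hv, hv, hw]
      · simp only [Set.mem_preimage, contraction_of_notMem hv, Set.mem_singleton_iff, hv, iff_false]
        rintro rfl
        exact hv (hw ▸ hx)
    rwa [this]
  · rintro ⟨a, ha⟩ ⟨b, hb⟩
    have key (v : V) (hv : contraction S x v = w) : v = w := by
      by_cases h : v ∈ S
      · rw [contraction_of_mem h] at hv
        exact absurd hv.symm hw
      · rwa [contraction_of_notMem h] at hv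
    obtain rfl := key a ha
    obtain rfl := key b hb
    rfl

/-- It suffices to check the conditions of a complete minor in one order. -/
theorem hasCompleteMinor_of_lt {m : ℕ} (f : Fin m → Set V) (h1 : ∀ i, (G.induce (f i)).Connected)
    (h2 : ∀ i j, i < j → Disjoint (f i) (f j))
    (h3 : ∀ i j, i < j → ∃ u ∈ f i, ∃ v ∈ f j, G.Adj u v) : HasCompleteMinor G m := by
  refine ⟨f, fun i => Set.nonempty_coe_sort.1 (h1 i).nonempty, h1, fun i j hij => ?_,
    fun i j hij => ?_⟩
  · rcases lt_or_gt_of_ne hij with h | h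
    exacts [h2 i j h, (h2 j i h).symm]
  · rcases lt_or_gt_of_ne hij with h | h
    · exact h3 i j h
    · obtain ⟨u, hu, v, hv, huv⟩ := h3 j i h
      exact ⟨v, hv, u, hu, huv.symm⟩

theorem hasCompleteMinor_of_valid {x : V} {e : ℕ → V} {n : ℕ}
    (he : ∀ i < n, ∀ j < n, e i = e j → i = j) (hx : ∀ i < n, G.Adj x (e i))
    {P : List (List ℕ)} (hP : NonEdgeSearch.Valid n P)
    (h1 : ∀ a b, [a, b] ∈ P → G.Adj (e a) (e b))
    (h2 : P.Pairwise fun A B => ∃ a ∈ A, ∃ b ∈ B, G.Adj (e a) (e b)) :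
    HasCompleteMinor G 6 := by
  obtain ⟨hlen, hnodup, hcard, hlt⟩ := hP
  rw [List.nodup_flatten] at hnodup
  have hdisj := List.pairwise_iff_getElem.1 hnodup.2
  have hadj := List.pairwise_iff_getElem.1 h2
  let f : Fin 5 → Set V := fun k => e '' {a | a ∈ P[k]}
  have hxf (k : Fin 5) : x ∉ f k := by
    rintro ⟨a, ha, hax⟩
    exact G.loopless.irrefl x (by simpa [hax] using hx a (hlt _ (List.getElem_mem _) a ha))
  refine hasCompleteMinor_of_lt (Fin.cons {x} f : Fin 6 → Set V) ?_ ?_ ?_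
  · intro i
    refine Fin.cases ?_ (fun k => ?_) i
    · change (G.induce {x}).Connected
      exact Connected.of_subsingleton
    · change (G.induce (f k)).Connected
      have hk : P[k] ∈ P := List.getElem_mem _
      rcases hcard _ hk with h | h
      · obtain ⟨a, ha⟩ := List.length_eq_one_iff.1 h
        have : f k = {e a} := by
          change e '' {b | b ∈ P[k]} = _
          simp [ha]
        rw [this]
        exact Connected.of_subsingleton
      · obtain ⟨a, b, ha⟩ := List.length_eq_two.1 h
        have : f k = {e a, e b} := by
          change e '' {c | c ∈ P[k]} = _
          rw [ha]
          ext v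
          simp [eq_comm]
        rw [this]
        exact induce_pair_connected_of_adj (h1 a b (ha ▸ hk))
  · intro i j
    refine Fin.cases ?_ (fun k => ?_) i <;> refine Fin.cases ?_ (fun l => ?_) j
    · simp
    · intro _
      simpa using hxf l
    · simp
    · intro hkl
      simp only [Fin.cons_succ]
      rw [Fin.succ_lt_succ_iff] at hkl
      rw [Set.disjoint_left]
      rintro _ ⟨a, ha, rfl⟩ ⟨b, hb, hab⟩
      have hd := hdisj k l (by omega) (by omega) hkl
      obtain rfl := he b (hlt _ (List.getElem_mem _) b hb) a (hlt _ (List.getElem_mem _) a ha) hab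
      exact hd ha hb
  · intro i j
    refine Fin.cases ?_ (fun k => ?_) i <;> refine Fin.cases ?_ (fun l => ?_) j
    · simp
    · intro _
      have hl : P[l] ∈ P := List.getElem_mem _
      obtain ⟨a, ha⟩ : ∃ a, a ∈ P[l] := List.exists_mem_of_length_pos (by
        rcases hcard _ hl with h | h <;> rw [h] <;> decide)
      exact ⟨x, rfl, e a, ⟨a, ha, rfl⟩, hx a (hlt _ hl a ha)⟩
    · simp
    · intro hkl
      rw [Fin.succ_lt_succ_iff] at hkl
      obtain ⟨a, ha, b, hb, hab⟩ := hadj k l (by omega) (by omega) hkl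
      exact ⟨e a, ⟨a, ha, rfl⟩, e b, ⟨b, hb, rfl⟩, hab⟩

end Minors

section Neighborhoods

open Finset

variable {V : Type} {G : SimpleGraph V}

open NonEdgeSearch in
theorem hasCompleteMinor_of_hasModel {x : V} {e : ℕ → V} {n m : ℕ} (h5 : 5 ≤ n) (h7 : n ≤ 7)
    (he : ∀ i < n, ∀ j < n, e i = e j → i = j) (hx : ∀ i < n, G.Adj x (e i))
    (hm : ∀ i < n, ∀ j < n, i ≠ j → m.testBit (idx i j) = false → G.Adj (e i) (e j))
    (h : hasModel n m = true) : HasCompleteMinor G 6 := by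
  obtain ⟨P, hP, h1, h2⟩ := exists_partition_of_hasModel h
  have hV := valid_of_mem_partitions h5 h7 P hP
  obtain ⟨-, hnodup, -, hlt⟩ := id hV
  rw [List.nodup_flatten] at hnodup
  refine hasCompleteMinor_of_valid he hx hV (fun a b hab => ?_) ?_
  · refine hm a (hlt _ hab a (by simp)) b (hlt _ hab b (by simp)) ?_ (h1 a b hab)
    have := hnodup.1 _ hab
    simp only [List.nodup_cons, List.mem_singleton] at this
    exact this.1
  · refine (h2.and hnodup.2).imp_of_mem fun {A B} hA hB hAB => ?_
    obtain ⟨⟨a, ha, b, hb, hab⟩, hd⟩ := hAB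
    exact ⟨a, ha, b, hb, hm a (hlt _ hA a ha) b (hlt _ hB b hb)
      (fun h => hd ha (h ▸ hb)) hab⟩

open Classical in
/-- The properties, used below, of the neighbourhoods with at most seven vertices and minimum
degree at least four which do not contain a complete minor on five vertices. -/
structure IsExceptional (G : SimpleGraph V) (x : V) (N : Finset V) : Prop where
  exists_card_le : ∃ y ∈ N, #{z ∈ N | G.Adj y z} ≤ 4
  hasCompleteMinor : ∀ u ∈ N, ∀ v ∈ N, u ≠ v → ¬G.Adj u v → ∀ G' : SimpleGraph V,
    (∀ w ∈ N, G'.Adj x w) → (∀ a ∈ N, ∀ b ∈ N, G.Adj a b → G'.Adj a b) → G'.Adj u v →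
    HasCompleteMinor G' 6
  exists_dominated : ∃ p ∈ N, ∃ q ∈ N, p ≠ q ∧ ¬G.Adj p q ∧ ∀ z ∈ N, G.Adj p z → G.Adj q z
  card_le_of_isClique : ∀ T ⊆ N, G.IsClique T → #T ≤ 3

open Classical in
theorem card_filter_adj_add {N : Finset V} {y : V} (hy : y ∈ N) :
    #{z ∈ N | G.Adj y z} + #{z ∈ N.erase y | ¬G.Adj y z} + 1 = #N := by
  have h1 : N.filter (G.Adj y) = (N.erase y).filter (G.Adj y) := by
    ext z
    simp only [mem_filter, mem_erase]
    exact ⟨fun h => ⟨⟨h.2.ne', h.1⟩, h.2⟩, fun h => ⟨h.1.2, h.2⟩⟩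
  rw [h1, card_filter_add_card_filter_not, card_erase_add_one hy]

open Classical in
/-- A labelling for which only the non-edges in `freePairs` are possible. -/
theorem exists_labelling {N : Finset V} (h5 : 5 ≤ #N) (h7 : #N ≤ 7)
    (hdeg : ∀ y ∈ N, 4 ≤ #{z ∈ N | G.Adj y z}) :
    ∃ e : ℕ → V, (∀ i < #N, e i ∈ N) ∧ (∀ i < #N, ∀ j < #N, e i = e j → i = j) ∧
      (∀ v ∈ N, ∃ i < #N, e i = v) ∧ (∀ j < #N, 3 ≤ j → G.Adj (e 0) (e j)) ∧
      ∀ j < #N, 5 ≤ j → G.Adj (e 1) (e j) := by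
  obtain ⟨v, hv⟩ : N.Nonempty := card_pos.1 (by omega)
  have hnon (y : V) (hy : y ∈ N) : #{z ∈ N.erase y | ¬G.Adj y z} ≤ 2 := by
    have := card_filter_adj_add (G := G) hy
    have := hdeg y hy
    omega
  have hv1 : #(N.erase v) = #N - 1 := card_erase_of_mem hv
  obtain ⟨A, hA1, hA2, hA⟩ := exists_subsuperset_card_eq (filter_subset _ (N.erase v))
    (hnon v hv) (by omega : 2 ≤ #(N.erase v))
  obtain ⟨p, q, hpq, rfl⟩ := card_eq_two.1 hA
  have hp : p ∈ N.erase v := hA2 (by simp)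
  have hq : q ∈ N.erase v := hA2 (by simp)
  rw [mem_erase] at hp hq
  have hR : #(N.erase v \ {p, q}) = #N - 3 := by
    rw [card_sdiff_of_subset hA2, hA, hv1]
    omega
  obtain ⟨B, hB1, hB2, hB⟩ := exists_subsuperset_card_eq
    (filter_subset (fun z => ¬G.Adj p z) (N.erase v \ {p, q})) ((card_le_card (fun z hz => by
      simp only [mem_filter, mem_sdiff, mem_erase, mem_insert, mem_singleton, not_or] at hz ⊢
      exact ⟨⟨hz.1.2.1, hz.1.1.2⟩, hz.2⟩)).trans (hnon p hp.2))
    (by omega : 2 ≤ #(N.erase v \ {p, q}))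
  obtain ⟨a, b, hab, rfl⟩ := card_eq_two.1 hB
  have ha : a ∈ N.erase v \ {p, q} := hB2 (by simp)
  have hb : b ∈ N.erase v \ {p, q} := hB2 (by simp)
  simp only [mem_sdiff, mem_erase, mem_insert, mem_singleton, not_or] at ha hb
  set R := (N.erase v \ {p, q}) \ {a, b} with hRdef
  let l : List V := v :: p :: q :: a :: b :: R.toList
  have hmemR (z : V) : z ∈ R ↔ z ∈ N ∧ z ≠ v ∧ z ≠ p ∧ z ≠ q ∧ z ≠ a ∧ z ≠ b := by
    simp only [hRdef, mem_sdiff, mem_erase, mem_insert, mem_singleton, not_or]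
    tauto
  have hmem (z : V) : z ∈ l ↔ z ∈ N := by
    simp only [l, List.mem_cons, mem_toList, hmemR]
    constructor
    · rintro (rfl | rfl | rfl | rfl | rfl | h)
      exacts [hv, hp.2, hq.2, ha.1.2, hb.1.2, h.1]
    · tauto
  have hnodup : l.Nodup := by
    simp only [l, List.nodup_cons, List.mem_cons, mem_toList, hmemR, nodup_toList]
    simp only [ne_eq] at *
    grind
  have hlen : l.length = #N := by
    rw [← List.toFinset_card_of_nodup hnodup]
    congr 1
    ext z
    rw [List.mem_toFinset, hmem]
  have hget (i : ℕ) (hi : i < #N) : l.getD i v = l[i]'(hlen ▸ hi) :=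
    List.getD_eq_getElem _ _ (hlen ▸ hi)
  have htail (i : ℕ) (hi : i < #N) (h : 5 ≤ i) : l.getD i v ∈ R := by
    rw [hget i hi]
    obtain ⟨i, rfl⟩ := Nat.exists_eq_add_of_le' h
    exact mem_toList.1 (List.getElem_mem _)
  have hvadj (z : V) (hz : z ∈ N) (h1 : z ≠ v) (h2 : z ≠ p) (h3 : z ≠ q) : G.Adj v z := by
    by_contra h
    have : z ∈ ({p, q} : Finset V) := hA1 (by simp [h, h1, hz])
    simp [h2, h3] at this
  refine ⟨fun i => l.getD i v, fun i hi => ?_, fun i hi j hj hij => ?_, fun z hz => ?_,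
    fun j hj hj3 => ?_, fun j hj hj5 => ?_⟩
  · change l.getD i v ∈ N
    rw [hget i hi, ← hmem]
    exact List.getElem_mem _
  · simp only [hget i hi, hget j hj] at hij
    exact (hnodup.getElem_inj_iff).1 hij
  · rw [← hmem] at hz
    obtain ⟨i, hi, rfl⟩ := List.getElem_of_mem hz
    exact ⟨i, hlen ▸ hi, hget i (hlen ▸ hi)⟩
  · change G.Adj v (l.getD j v)
    rcases (by omega : j = 3 ∨ j = 4 ∨ 5 ≤ j) with rfl | rfl | h
    · exact hvadj a ha.1.2 ha.1.1 ha.2.1 ha.2.2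
    · exact hvadj b hb.1.2 hb.1.1 hb.2.1 hb.2.2
    · obtain ⟨h1, h2, h3, h4, -⟩ := (hmemR _).1 (htail j hj h)
      exact hvadj _ h1 h2 h3 h4
  · change G.Adj p (l.getD j v)
    obtain ⟨h1, h2, h3, h4, h5, h6⟩ := (hmemR _).1 (htail j hj hj5)
    generalize l.getD j v = w at *
    by_contra h
    have : w ∈ ({a, b} : Finset V) := hB1 (by simp [h, h1, h2, h3, h4])
    simp [h5, h6] at this

open NonEdgeSearch Classical in
theorem hasCompleteMinor_or_isExceptional {x : V} {N : Finset V} (hx : ∀ v ∈ N, G.Adj x v)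
    (h5 : 5 ≤ #N) (h7 : #N ≤ 7) (hdeg : ∀ y ∈ N, 4 ≤ #{z ∈ N | G.Adj y z}) :
    HasCompleteMinor G 6 ∨ IsExceptional G x N := by
  obtain ⟨e, heN, hinj, hsurj, hadj0, hadj1⟩ := exists_labelling h5 h7 hdeg
  have hcount (i : ℕ) (hi : i < #N) : #{z ∈ N | G.Adj (e i) z} +
      #{j ∈ range #N | j ≠ i ∧ ¬G.Adj (e i) (e j)} + 1 = #N := by
    refine Eq.trans ?_ (card_filter_adj_add (G := G) (heN i hi))
    congr 2
    refine card_bij (fun j _ => e j) (fun j hj => ?_) (fun j hj k hk hjk => ?_) (fun z hz => ?_)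
    · simp only [mem_filter, mem_range, mem_erase] at hj ⊢
      exact ⟨⟨fun h => hj.2.1 (hinj j hj.1 i hi h), heN j hj.1⟩, hj.2.2⟩
    · simp only [mem_filter, mem_range] at hj hk
      exact hinj j hj.1 k hk.1 hjk
    · simp only [mem_filter, mem_erase] at hz
      obtain ⟨j, hj, rfl⟩ := hsurj z hz.1.2
      exact ⟨j, by simp only [mem_filter, mem_range]; exact ⟨hj, fun h => hz.1.1 (h ▸ rfl), hz.2⟩,
        rfl⟩
  let β : ℕ → Prop := fun t => ∀ i j, i < j → j < #N → t = idx i j → ¬G.Adj (e i) (e j)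
  have hβadj {m i j : ℕ} (hm : ∀ t, m.testBit t = true → β t) (hi : i < #N) (hj : j < #N)
      (hij : i ≠ j) (h : m.testBit (idx i j) = true) : ¬G.Adj (e i) (e j) := by
    rcases lt_or_gt_of_ne hij with hlt | hlt
    · exact hm _ h i j hlt hj rfl
    · rw [idx_comm] at h
      exact fun hadj => hm _ h j i hlt hi rfl hadj.symm
  have hcrowded {m i k : ℕ} (hm : ∀ t, m.testBit t = true → β t) (hi : i < #N)
      (h : crowded #N k m i = true) : #{z ∈ N | G.Adj (e i) z} + k + 2 ≤ #N := by
    have h1 := card_lt_of_crowded h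
    have h2 := hcount i hi
    have h3 : #{j ∈ range #N | j ≠ i ∧ m.testBit (idx i j) = true} ≤
        #{j ∈ range #N | j ≠ i ∧ ¬G.Adj (e i) (e j)} := by
      refine card_le_card fun j hj => ?_
      simp only [mem_filter, mem_range] at hj ⊢
      exact ⟨hj.1, hj.2.1, hβadj hm hi hj.1 (Ne.symm hj.2.1) hj.2.2⟩
    omega
  obtain ⟨M, hMβ, -, hM, hres⟩ := exists_of_search β
    (fun m i hi hm => by
      by_contra h
      have h1 := hcrowded hm hi (by simpa using h)
      have h2 := hdeg _ (heN i hi)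
      omega)
    (freePairs #N) 0
    (fun p hp => by
      have := mem_pairs.1 (List.mem_of_mem_filter hp)
      omega)
    (by omega) (by simp) (search_freePairs h5 h7)
  have hMlt {i j : ℕ} (hij : i < j) (hj : j < #N) (h : M.testBit (idx i j) = false) :
      G.Adj (e i) (e j) := by
    by_contra hadj
    have hfree : (i, j) ∈ freePairs #N := by
      refine mem_freePairs (mem_pairs.2 ⟨hij, hj⟩) (fun h => ?_) (fun h => ?_)
      · dsimp only at h ⊢
        by_contra hlt
        exact hadj (h ▸ hadj0 j hj (by omega))
      · dsimp only at h ⊢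
        by_contra hlt
        exact hadj (h ▸ hadj1 j hj (by omega))
    have := hM _ hfree (fun i' j' hij' hj' h' => by
      rw [idx_of_lt hij, idx_of_lt hij'] at h'
      obtain ⟨rfl, rfl⟩ : i = i' ∧ j = j' := by omega
      exact hadj)
    simp [h] at this
  have hMadj {i j : ℕ} (hi : i < #N) (hj : j < #N) (hij : i ≠ j) :
      M.testBit (idx i j) = false ↔ G.Adj (e i) (e j) := by
    refine ⟨fun h => ?_, fun h => ?_⟩
    · rcases lt_or_gt_of_ne hij with hlt | hlt
      · exact hMlt hlt hj h
      · rw [idx_comm] at h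
        exact (hMlt hlt hi h).symm
    · by_contra h'
      exact hβadj hMβ hi hj hij (by simpa using h') h
  rcases hres with hres | hres
  · exact .inl (hasCompleteMinor_of_hasModel h5 h7 hinj (fun i hi => hx _ (heN i hi))
      (fun i hi j hj hij => (hMadj hi hj hij).1) hres)
  right
  simp only [exceptional, andR_eq, orR_eq, anyR_eq, allR_eq, Bool.and_eq_true, List.any_eq_true,
    List.all_eq_true, List.mem_range, Bool.or_eq_true, Bool.not_eq_true', misses_digit] at hres
  obtain ⟨⟨y, hy, hycr⟩, hpairs, ⟨p, hp, hpb, hdom⟩, hquads⟩ := hres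
  rw [mem_pairs] at hp
  refine ⟨⟨e y, heN y hy, ?_⟩, ?_, ?_, ?_⟩
  · have := hcrowded hMβ hy hycr
    omega
  · have main (i j : ℕ) (hij : i < j) (hj : j < #N) (hnadj : ¬G.Adj (e i) (e j))
        (G' : SimpleGraph V) (h1 : ∀ w ∈ N, G'.Adj x w)
        (h2 : ∀ a ∈ N, ∀ b ∈ N, G.Adj a b → G'.Adj a b) (h3 : G'.Adj (e i) (e j)) :
        HasCompleteMinor G' 6 := by
      refine hasCompleteMinor_of_hasModel h5 h7 hinj (fun i hi => h1 _ (heN i hi))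
        (fun a ha b hb hab h => ?_)
        ((hpairs (i, j) (mem_pairs.2 ⟨hij, hj⟩)).resolve_left
          fun h => hnadj ((hMadj (hij.trans hj) hj hij.ne).1 h))
      change Nat.testBit (M ^^^ digit i j) _ = false at h
      rw [Nat.testBit_xor, testBit_digit] at h
      by_cases h' : idx i j = idx a b
      · rcases lt_or_gt_of_ne hab with hlt | hlt
        · rw [idx_of_lt hij, idx_of_lt hlt] at h'
          obtain ⟨rfl, rfl⟩ : i = a ∧ j = b := by omega
          exact h3
        · rw [idx_comm a b, idx_of_lt hij, idx_of_lt hlt] at h'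
          obtain ⟨rfl, rfl⟩ : i = b ∧ j = a := by omega
          exact h3.symm
      · refine h2 _ (heN a ha) _ (heN b hb) ((hMadj ha hb hab).1 ?_)
        simpa [h'] using h
    intro u hu v hv huv hnadj G' h1 h2 h3
    obtain ⟨i, hi, rfl⟩ := hsurj u hu
    obtain ⟨j, hj, rfl⟩ := hsurj v hv
    rcases lt_trichotomy i j with hlt | rfl | hlt
    · exact main i j hlt hj hnadj G' h1 h2 h3
    · exact absurd rfl huv
    · exact main j i hlt hi (fun h => hnadj h.symm) G' h1 h2 h3.symm
  · refine ⟨e p.1, heN _ (hp.1.trans hp.2), e p.2, heN _ hp.2,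
      fun h => hp.1.ne (hinj _ (hp.1.trans hp.2) _ hp.2 h), fun h => ?_, fun z hz hpz => ?_⟩
    · have := (hMadj (hp.1.trans hp.2) hp.2 hp.1.ne).2 h
      exact absurd ((misses_digit.2 this).symm.trans hpb) (by decide)
    · obtain ⟨k, hk, rfl⟩ := hsurj z hz
      have h1k : p.1 ≠ k := by
        rintro rfl
        exact G.loopless.irrefl _ hpz
      have h2k : p.2 ≠ k := by
        rintro rfl
        have := (hMadj (hp.1.trans hp.2) hp.2 hp.1.ne).2 hpz
        exact absurd ((misses_digit.2 this).symm.trans hpb) (by decide)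
      rcases hdom k hk with (h | h) | h | h
      · exact absurd (Nat.eq_of_beq_eq_true h) h1k
      · exact absurd (Nat.eq_of_beq_eq_true h) h2k
      · exact (hMadj hp.2 hk h2k).1 h
      · have := (hMadj (hp.1.trans hp.2) hk h1k).2 hpz
        rw [misses_digit.2 this] at h
        exact absurd h (by decide)
  · intro T hT hclique
    by_contra! hcard
    have hI : 4 ≤ #{i ∈ range #N | e i ∈ T} := by
      refine le_trans (le_trans hcard (card_le_card fun z hz => ?_)) (card_image_le (f := e))
      obtain ⟨i, hi, rfl⟩ := hsurj z (hT hz)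
      exact mem_image_of_mem e (by simp [hi, hz])
    obtain ⟨I, hIsub, hI⟩ := exists_subset_card_eq hI
    have hmem (k : Fin 4) := mem_filter.1 (hIsub (I.orderEmbOfFin_mem hI k))
    have hlt {k l : Fin 4} (hkl : k < l) : I.orderEmbOfFin hI k < I.orderEmbOfFin hI l :=
      (I.orderEmbOfFin hI).strictMono hkl
    generalize I.orderEmbOfFin hI = o at hmem hlt
    have hbit {k l : Fin 4} (hkl : k < l) : M.testBit (idx (o k) (o l)) = false := by
      refine (hMadj (mem_range.1 (hmem k).1) (mem_range.1 (hmem l).1) (hlt hkl).ne).2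
        (hclique (hmem k).2 (hmem l).2 fun h => (hlt hkl).ne ?_)
      exact hinj _ (mem_range.1 (hmem k).1) _ (mem_range.1 (hmem l).1) h
    have hq : Nat.lor (digit (o 0) (o 1)) (Nat.lor (digit (o 2) (o 3))
        (mask [o 0, o 1] [o 2, o 3])) ∈ quads #N := by
      rw [quads, List.mem_flatMap]
      refine ⟨(o 0, o 1), mem_pairs.2 ⟨hlt (by decide), mem_range.1 (hmem 1).1⟩, ?_⟩
      refine List.mem_map.2 ⟨(o 2, o 3), List.mem_filter.2
        ⟨mem_pairs.2 ⟨hlt (by decide), mem_range.1 (hmem 3).1⟩, ?_⟩, rfl⟩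
      simp [hlt (by decide : (1 : Fin 4) < 2)]
    have h := hquads _ hq
    rw [← Bool.not_eq_true, Nat.beq_eq] at h
    refine h (Nat.eq_of_testBit_eq fun t => ?_)
    change Nat.testBit (M &&& (digit (o 0) (o 1) ||| (digit (o 2) (o 3) |||
      mask [o 0, o 1] [o 2, o 3]))) t = _
    rw [Nat.zero_testBit, ← Bool.not_eq_true, Nat.testBit_and, Nat.testBit_or, Nat.testBit_or,
      Bool.and_eq_true, Bool.or_eq_true, Bool.or_eq_true, testBit_mask, testBit_digit, testBit_digit,
      decide_eq_true_iff, decide_eq_true_iff]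
    rintro ⟨hMt, rfl | rfl | ⟨a, ha, b, hb, rfl⟩⟩
    · simp [hbit (by decide : (0 : Fin 4) < 1)] at hMt
    · simp [hbit (by decide : (2 : Fin 4) < 3)] at hMt
    · simp only [List.mem_cons, List.not_mem_nil, or_false] at ha hb
      rcases ha with rfl | rfl <;> rcases hb with rfl | rfl
      · simp [hbit (by decide : (0 : Fin 4) < 2)] at hMt
      · simp [hbit (by decide : (0 : Fin 4) < 3)] at hMt
      · simp [hbit (by decide : (1 : Fin 4) < 2)] at hMt
      · simp [hbit (by decide : (1 : Fin 4) < 3)] at hMt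

end Neighborhoods

section Components

variable {V : Type} {G : SimpleGraph V}

/-- The vertex set of a component of an induced subgraph. -/
theorem exists_component {D : Set V} {z : V} (hz : z ∈ D) :
    ∃ C ⊆ D, z ∈ C ∧ (G.induce C).Connected ∧ ∀ u ∈ C, ∀ v ∈ D, G.Adj u v → v ∈ C := by
  let C : Set V := {v | ∃ h : v ∈ D, (G.induce D).Reachable ⟨z, hz⟩ ⟨v, h⟩}
  have hC : ∀ u ∈ C, ∀ v ∈ D, G.Adj u v → v ∈ C := by
    rintro u ⟨hu, hzu⟩ v hv huv
    exact ⟨hv, hzu.trans (Adj.reachable huv)⟩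
  have hzC : z ∈ C := ⟨hz, .refl _⟩
  have key {a b : D} (p : (G.induce D).Walk a b) (ha : a.1 ∈ C) :
      ∃ hb : b.1 ∈ C, (G.induce C).Reachable ⟨a, ha⟩ ⟨b, hb⟩ := by
    induction p with
    | nil => exact ⟨ha, .refl _⟩
    | cons h p ih =>
      rename_i u v w
      obtain ⟨hb, hr⟩ := ih (hC u ha v v.2 h)
      exact ⟨hb, (Adj.reachable (G := G.induce C) (u := ⟨u, ha⟩) (v := ⟨v, hC u ha v v.2 h⟩)
        h).trans hr⟩
  refine ⟨C, fun v hv => hv.1, hzC, ?_, hC⟩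
  rw [connected_iff_exists_forall_reachable]
  refine ⟨⟨z, hzC⟩, ?_⟩
  rintro ⟨v, hv, ⟨p⟩⟩
  exact (key p hzC).2

theorem isClique_attachments {x : V} {N : Finset V} {C : Set V} (hx : ∀ v ∈ N, G.Adj x v)
    (hex : IsExceptional G x N) (hG : ¬HasCompleteMinor G 6) (hxC : x ∉ C)
    (hC : (G.induce C).Connected) (hNC : ∀ v ∈ N, v ∉ C) {T : Finset V} (hTN : T ⊆ N)
    (hT : ∀ t ∈ T, ∃ u ∈ C, G.Adj u t) : G.IsClique T := by
  intro i hi j hj hij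
  by_contra hnadj
  have hfix {w : V} (hw : w ∉ C) : contraction (C ∪ {i}) i w = w := by
    by_cases h : w = i
    · rw [h]
      exact contraction_of_mem (by simp)
    · exact contraction_of_notMem (by simp [h, hw])
  obtain ⟨u, hu, hui⟩ := hT i hi
  obtain ⟨v, hv, hvj⟩ := hT j hj
  have hconn : (G.induce (C ∪ {i})).Connected := by
    exact connected_induce_union hC.preconnected Preconnected.of_subsingleton hu rfl hui
  refine hG (HasCompleteMinor.of_contraction (S := C ∪ {i}) (x := i) (by simp)
    hconn.preconnected (by norm_num) ?_)
  refine hex.hasCompleteMinor i (hTN hi) j (hTN hj) hij hnadj _ (fun w hw => ?_)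
    (fun a ha b hb hab => ?_) ?_ <;> rw [map_adj']
  · exact ⟨(hx w hw).ne, x, w, hx w hw, hfix hxC, hfix (hNC w hw)⟩
  · exact ⟨hab.ne, a, b, hab, hfix (hNC a ha), hfix (hNC b hb)⟩
  · exact ⟨hij, v, j, hvj, contraction_of_mem (.inl hv), hfix (hNC j (hTN hj))⟩

end Components

section EdgeCount

open Finset Classical

variable {V : Type} [Fintype V] {G : SimpleGraph V} {s : Finset V}

theorem sum_degrees_of_support (hs : ∀ u v, G.Adj u v → u ∈ s) :
    ∑ v ∈ s, G.degree v = 2 * #G.edgeFinset := by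
  rw [← G.sum_degrees_eq_twice_card_edges]
  refine sum_subset (subset_univ s) fun v _ hv => ?_
  rw [← card_neighborFinset_eq_degree, card_eq_zero, eq_empty_iff_forall_notMem]
  exact fun w hw => hv (hs v w ((G.mem_neighborFinset v w).1 hw))

theorem two_mul_card_edgeFinset_le (hs : ∀ u v, G.Adj u v → u ∈ s) :
    2 * #G.edgeFinset ≤ #s * (#s - 1) := by
  rw [← sum_degrees_of_support hs]
  refine (sum_le_card_nsmul s _ (#s - 1) fun v hv => ?_).trans_eq (smul_eq_mul _ _)
  rw [← card_neighborFinset_eq_degree, ← card_erase_of_mem hv]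
  refine card_le_card fun w hw => ?_
  rw [mem_neighborFinset] at hw
  exact mem_erase.2 ⟨hw.ne', hs w v hw.symm⟩

theorem exists_degree_le_seven (hs : ∀ u v, G.Adj u v → u ∈ s) (h : #G.edgeFinset + 8 = 4 * #s) :
    ∃ x ∈ s, G.degree x ≤ 7 := by
  by_contra! hdeg
  have h1 := card_nsmul_le_sum s _ 8 hdeg
  rw [sum_degrees_of_support hs, smul_eq_mul] at h1
  omega

theorem exists_le_card_edgeFinset_eq {k : ℕ} (h : k ≤ #G.edgeFinset) :
    ∃ G' ≤ G, #G'.edgeFinset = k := by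
  obtain ⟨F, hF, hk⟩ := exists_subset_card_eq h
  have hFG : (F : Set (Sym2 V)) ⊆ G.edgeSet := fun e he => mem_edgeFinset.1 (hF he)
  have hE : (fromEdgeSet (F : Set (Sym2 V))).edgeSet = F := by
    rw [edgeSet_fromEdgeSet, sdiff_eq_left, Set.disjoint_left]
    exact fun e he hd => G.not_isDiag_of_mem_edgeSet (hFG he) (by simpa using hd)
  have hcard (G' : SimpleGraph V) (h : G'.edgeSet = F) : #G'.edgeFinset = k := by
    rw [← hk]
    congr 1
    ext e
    rw [mem_edgeFinset, h, mem_coe]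
  exact ⟨fromEdgeSet F, by rwa [← edgeSet_subset_edgeSet, hE], hcard _ hE⟩

theorem card_edgeFinset_le_of_contraction {x y : V} {H : SimpleGraph V}
    (hH : H = G.map (contraction {x, y} x)) :
    #G.edgeFinset ≤ #H.edgeFinset + #{z | G.Adj x z ∧ G.Adj y z} + 1 := by
  have hfix {v : V} (hv : v ≠ y) : contraction {x, y} x v = v := by
    by_cases h : v = x
    · rw [h]
      exact contraction_of_mem (by simp)
    · exact contraction_of_notMem (by simp [h, hv])
  have hy : contraction {x, y} x y = x := contraction_of_mem (by simp)
  set A := {e ∈ G.edgeFinset | y ∉ e}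
  set Z := {z ∈ G.neighborFinset y | ¬G.Adj x z ∧ z ≠ x}
  have hZ {z : V} (hz : z ∈ Z) : G.Adj y z ∧ ¬G.Adj x z ∧ z ≠ x := by
    simpa [Z] using hz
  have hsub : A ∪ Z.image (fun z => s(x, z)) ⊆ H.edgeFinset := by
    refine union_subset (fun e => ?_) (fun e he => ?_)
    · refine e.inductionOn fun u v => ?_
      simp only [A, mem_filter, mem_edgeFinset, mem_edgeSet, Sym2.mem_iff, not_or, and_imp]
      intro huv hu hv
      rw [hH, map_adj']
      exact ⟨huv.ne, u, v, huv, hfix (Ne.symm hu), hfix (Ne.symm hv)⟩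
    · obtain ⟨z, hz, rfl⟩ := mem_image.1 he
      have hz := hZ hz
      rw [mem_edgeFinset, mem_edgeSet, hH, map_adj']
      exact ⟨hz.2.2.symm, y, z, hz.1, hy, hfix hz.1.ne'⟩
  have hdisj : Disjoint A (Z.image fun z => s(x, z)) := by
    rw [disjoint_right]
    intro e he heA
    obtain ⟨z, hz, rfl⟩ := mem_image.1 he
    simp only [A, mem_filter, mem_edgeFinset, mem_edgeSet] at heA
    exact (hZ hz).2.1 heA.1
  have himage : #(Z.image fun z => s(x, z)) = #Z := by
    refine card_image_of_injective _ fun a b hab => ?_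
    exact Sym2.congr_right.1 hab
  have h1 := card_le_card hsub
  rw [card_union_of_disjoint hdisj, himage] at h1
  have h2 : #A + G.degree y = #G.edgeFinset := by
    rw [← G.card_incidenceFinset_eq_degree,
      ← card_filter_add_card_filter_not (s := G.edgeFinset) (fun e => y ∉ e)]
    refine congrArg (#A + ·) (congrArg card ?_)
    ext e
    simp [incidenceSet]
  have h3 : G.degree y ≤ #Z + #{z | G.Adj x z ∧ G.Adj y z} + 1 := by
    rw [← card_neighborFinset_eq_degree, ← card_singleton x, add_assoc]
    refine (card_le_card (t := Z ∪ (_ ∪ _)) fun z hz => ?_).trans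
      ((card_union_le _ _).trans (Nat.add_le_add_left (card_union_le _ _) _))
    rw [mem_neighborFinset] at hz
    simp only [Z, mem_union, mem_filter, mem_neighborFinset, mem_univ, mem_singleton]
    tauto
  omega

/-- The edges with both ends in a given set. -/
def restrictTo (G : SimpleGraph V) (A : Finset V) : SimpleGraph V where
  Adj u v := G.Adj u v ∧ u ∈ A ∧ v ∈ A
  symm := ⟨fun _ _ h => ⟨h.1.symm, h.2.2, h.2.1⟩⟩
  loopless := ⟨fun _ h => G.loopless.irrefl _ h.1⟩

theorem card_edgeFinset_add_restrictTo_inter_le {A B : Finset V}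
    (h : ∀ u v, G.Adj u v → u ∈ A ∧ v ∈ A ∨ u ∈ B ∧ v ∈ B) :
    #G.edgeFinset + #(restrictTo G (A ∩ B)).edgeFinset ≤
      #(restrictTo G A).edgeFinset + #(restrictTo G B).edgeFinset := by
  rw [← card_union_add_card_inter (restrictTo G A).edgeFinset]
  refine Nat.add_le_add (card_le_card fun e => ?_) (card_le_card fun e => ?_)
  · refine e.inductionOn fun u v huv => ?_
    rw [mem_edgeFinset, mem_edgeSet] at huv
    rw [mem_union, mem_edgeFinset, mem_edgeFinset, mem_edgeSet, mem_edgeSet]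
    exact (h u v huv).imp (⟨huv, ·⟩) (⟨huv, ·⟩)
  · refine e.inductionOn fun u v huv => ?_
    rw [mem_edgeFinset, mem_edgeSet] at huv
    rw [mem_inter, mem_edgeFinset, mem_edgeFinset, mem_edgeSet, mem_edgeSet]
    obtain ⟨h1, h2, h3⟩ := huv
    rw [mem_inter] at h2 h3
    exact ⟨⟨h1, h2.1, h3.1⟩, h1, h2.2, h3.2⟩

theorem three_le_card_edgeFinset_restrictTo {T : Finset V} (hT : G.IsClique T) (h3 : #T = 3) :
    3 ≤ #(restrictTo G T).edgeFinset := by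
  obtain ⟨a, b, c, hab, hac, hbc, rfl⟩ := card_eq_three.1 h3
  have hsub : ({s(a, b), s(a, c), s(b, c)} : Finset (Sym2 V)) ⊆
      (restrictTo G {a, b, c}).edgeFinset := by
    have hadj {u v : V} (hu : u ∈ ({a, b, c} : Finset V)) (hv : v ∈ ({a, b, c} : Finset V))
        (huv : u ≠ v) : (restrictTo G {a, b, c}).Adj u v := ⟨hT hu hv huv, hu, hv⟩
    intro e he
    simp only [mem_insert, mem_singleton] at he
    rw [mem_edgeFinset]
    rcases he with rfl | rfl | rfl
    exacts [hadj (by simp) (by simp) hab, hadj (by simp) (by simp) hac,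
      hadj (by simp) (by simp) hbc]
  refine le_trans (Eq.ge ?_) (card_le_card hsub)
  refine card_eq_three.2 ⟨_, _, _, ?_, ?_, ?_, rfl⟩ <;> simp <;> grind

end EdgeCount

section DenseGraphs

open Finset Classical

variable {V : Type} [Fintype V] {G : SimpleGraph V} {s : Finset V}

theorem card_filter_neighborFinset (x y : V) :
    #{z ∈ G.neighborFinset x | G.Adj y z} = #{z | G.Adj x z ∧ G.Adj y z} := by
  congr 1
  ext z
  simp

theorem exists_outside_neighbor {x : V} {N : Finset V} (hN : N = G.neighborFinset x)
    (hcommon : ∀ u v, G.Adj u v → 4 ≤ #{z | G.Adj u z ∧ G.Adj v z}) (hex : IsExceptional G x N)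
    (hG : ¬HasCompleteMinor G 6) : ∃ y ∈ N, ∃ z, G.Adj y z ∧ z ≠ x ∧ ¬G.Adj x z := by
  obtain ⟨y, hy, hy4⟩ := hex.exists_card_le
  subst hN
  refine ⟨y, hy, ?_⟩
  have hxy : G.Adj x y := (G.mem_neighborFinset x y).1 hy
  by_contra! hz
  have hcard : #(G.neighborFinset y) ≤ 5 := by
    refine (card_le_card (t := insert x {z ∈ G.neighborFinset x | G.Adj y z}) fun z hyz => ?_).trans
      ((card_insert_le _ _).trans (by omega))
    rw [mem_neighborFinset] at hyz
    rw [mem_insert, mem_filter, mem_neighborFinset]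
    by_cases h : z = x
    · exact .inl h
    · exact .inr ⟨hz z hyz h, hyz⟩
  have hdeg (v : V) (hv : v ∈ G.neighborFinset y) :
      4 ≤ #{z ∈ G.neighborFinset y | G.Adj v z} := by
    rw [card_filter_neighborFinset]
    exact hcommon _ _ ((G.mem_neighborFinset _ _).1 hv)
  have h5 : 5 ≤ #(G.neighborFinset y) := by
    have hx : x ∈ G.neighborFinset y := (G.mem_neighborFinset y x).2 hxy.symm
    have := card_filter_adj_add (G := G) hx
    have := hdeg x hx
    omega
  obtain ⟨p, hp, q, hq, hpq, hnadj, -⟩ := ((hasCompleteMinor_or_isExceptional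
    (fun v hv => (G.mem_neighborFinset y v).1 hv) h5 (by omega) hdeg).resolve_left
      hG).exists_dominated
  have h1 := card_filter_adj_add (G := G) hp
  have h2 : 1 ≤ #{z ∈ (G.neighborFinset y).erase p | ¬G.Adj p z} :=
    card_pos.2 ⟨q, by simp [hpq.symm, hnadj, (G.mem_neighborFinset y q).1 hq]⟩
  have h3 := hdeg p hp
  omega

theorem hasCompleteMinor_of_card_edgeFinset_eq (hs : ∀ u v, G.Adj u v → u ∈ s) (h3 : 3 ≤ #s)
    (hE : #G.edgeFinset + 8 = 4 * #s)
    (ih : ∀ (s' : Finset V) (G' : SimpleGraph V), #s' < #s → (∀ u v, G'.Adj u v → u ∈ s') →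
      3 ≤ #s' → 4 * #s' ≤ #G'.edgeFinset + 8 → HasCompleteMinor G' 6) :
    HasCompleteMinor G 6 := by
  by_contra hG
  have h4 : 4 ≤ #s := by
    have := two_mul_card_edgeFinset_le hs
    by_contra h
    obtain h : #s = 3 := by omega
    rw [h] at this hE
    omega
  have hcommon (x y : V) (hxy : G.Adj x y) : 4 ≤ #{z | G.Adj x z ∧ G.Adj y z} := by
    by_contra h
    have hys : y ∈ s := hs y x hxy.symm
    have hle := card_edgeFinset_le_of_contraction (x := x) (y := y) (G := G) rfl
    have herase := card_erase_add_one hys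
    refine hG (HasCompleteMinor.of_contraction (S := {x, y}) (x := x) (by simp)
      (induce_pair_connected_of_adj hxy).preconnected (by norm_num)
      (ih (s.erase y) _ (by omega) ?_ (by omega) (by omega)))
    rintro u v ⟨-, a, b, hab, rfl, -⟩
    rw [mem_erase]
    by_cases ha : a ∈ ({x, y} : Set V)
    · rw [contraction_of_mem ha]
      exact ⟨hxy.ne, hs x y hxy⟩
    · rw [contraction_of_notMem ha]
      refine ⟨fun h => ha (by simp [h]), hs a b hab⟩
  have hneighbor (x : V) (hx : x ∈ s) : ∃ y, G.Adj x y := by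
    by_contra! h
    have := card_erase_add_one hx
    refine hG (ih (s.erase x) G (by omega) (fun u v huv => ?_) (by omega) (by omega))
    exact mem_erase.2 ⟨fun hux => h v (hux ▸ huv), hs u v huv⟩
  have hdeg (x : V) (hx : x ∈ s) : 5 ≤ #(G.neighborFinset x) := by
    obtain ⟨y, hy⟩ := hneighbor x hx
    have h1 := card_filter_adj_add (G := G) ((G.mem_neighborFinset x y).2 hy)
    rw [card_filter_neighborFinset] at h1
    have := hcommon x y hy
    omega
  obtain ⟨x, hx, hx7⟩ := exists_degree_le_seven hs hE
  rw [← card_neighborFinset_eq_degree] at hx7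
  have hadj (v : V) (hv : v ∈ G.neighborFinset x) : G.Adj x v := (G.mem_neighborFinset x v).1 hv
  have hex := (hasCompleteMinor_or_isExceptional hadj (hdeg x hx) hx7 (fun v hv => by
    rw [card_filter_neighborFinset]
    exact hcommon _ _ (hadj v hv))).resolve_left hG
  obtain ⟨y, hy, z, hyz, hzx, hxz⟩ := exists_outside_neighbor rfl hcommon hex hG
  obtain ⟨C, hCD, hzC, hCconn, hC⟩ :=
    exists_component (G := G) (D := {v | v ∈ s ∧ v ≠ x ∧ ¬G.Adj x v}) (z := z)
      ⟨hs z y hyz.symm, hzx, hxz⟩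
  have hxC : x ∉ C := fun h => (hCD h).2.1 rfl
  set T := {t ∈ G.neighborFinset x | ∃ u ∈ C, G.Adj u t} with hTdef
  have hTN : T ⊆ G.neighborFinset x := filter_subset _ _
  have hT : G.IsClique T := isClique_attachments hadj hex hG hxC hCconn
    (fun v hv h => (hCD h).2.2 (hadj v hv)) hTN (fun t ht => (mem_filter.1 ht).2)
  have hT3 := hex.card_le_of_isClique T hTN hT
  have hTC (t : V) (ht : t ∈ T) : t ∉ C.toFinset := fun h =>
    (hCD (Set.mem_toFinset.1 h)).2.2 (hadj t (hTN ht))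
  have hCout (u v : V) (hu : u ∈ C) (huv : G.Adj u v) : v ∈ C.toFinset ∪ T := by
    rw [mem_union, Set.mem_toFinset, hTdef, mem_filter, mem_neighborFinset]
    by_cases hxv : G.Adj x v
    · exact .inr ⟨hxv, u, hu, huv⟩
    · exact .inl (hC u hu v ⟨hs v u huv.symm, fun h => (hCD hu).2.2 (h ▸ huv.symm), hxv⟩ huv)
  have hCs : C.toFinset ⊆ s := fun u hu => (hCD (Set.mem_toFinset.1 hu)).1
  have hTs : T ⊆ s := fun t ht => hs t x (hadj t (hTN ht)).symm
  have hA := card_sdiff_add_card_eq_card hCs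
  have hCpos : 0 < #C.toFinset := card_pos.2 ⟨z, Set.mem_toFinset.2 hzC⟩
  have hB : #(C.toFinset ∪ T) = #C.toFinset + #T :=
    card_union_of_disjoint (disjoint_right.2 hTC)
  have hAB : (s \ C.toFinset) ∩ (C.toFinset ∪ T) = T := by
    ext v
    simp only [mem_inter, mem_sdiff, mem_union]
    constructor
    · tauto
    · exact fun hv => ⟨⟨hTs hv, hTC v hv⟩, .inr hv⟩
  have hrestrict (A : Finset V) (hA : #A < #s) (hA3 : 3 ≤ #A) :
      #(restrictTo G A).edgeFinset + 9 ≤ 4 * #A := by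
    by_contra h
    exact hG ((ih A (restrictTo G A) hA (fun _ _ h => h.2.1) hA3 (by omega)).mono
      fun _ _ (h : (restrictTo G A).Adj _ _) => h.1)
  have hEA := hrestrict (s \ C.toFinset) (by omega) ((hdeg x hx).trans' (by norm_num) |>.trans
    (card_le_card fun v hv => mem_sdiff.2 ⟨hs v x (hadj v hv).symm, fun h =>
      (hCD (Set.mem_toFinset.1 h)).2.2 (hadj v hv)⟩))
  have hEB := hrestrict (C.toFinset ∪ T)
    (card_lt_card ((ssubset_iff_of_subset (union_subset hCs hTs)).2 ⟨x, hx, fun h => by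
      rcases mem_union.1 h with h | h
      · exact hxC (Set.mem_toFinset.1 h)
      · exact G.loopless.irrefl x (hadj x (hTN h))⟩))
    ((hdeg z (hCs (Set.mem_toFinset.2 hzC))).trans' (by norm_num) |>.trans
      (card_le_card fun v hv => hCout z v hzC ((G.mem_neighborFinset z v).1 hv)))
  have hsum := card_edgeFinset_add_restrictTo_inter_le (G := G) (A := s \ C.toFinset)
    (B := C.toFinset ∪ T) fun u v huv => by
      by_cases hu : u ∈ C
      · exact .inr ⟨mem_union_left _ (Set.mem_toFinset.2 hu), hCout u v hu huv⟩
      by_cases hv : v ∈ C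
      · exact .inr ⟨hCout v u hv huv.symm, mem_union_left _ (Set.mem_toFinset.2 hv)⟩
      · exact .inl ⟨mem_sdiff.2 ⟨hs u v huv, by simpa using hu⟩,
          mem_sdiff.2 ⟨hs v u huv.symm, by simpa using hv⟩⟩
  rw [hAB] at hsum
  by_cases h : #T = 3
  · have := three_le_card_edgeFinset_restrictTo hT h
    omega
  · omega

theorem hasCompleteMinor_of_le_card_edgeFinset (s : Finset V) :
    ∀ G : SimpleGraph V, (∀ u v, G.Adj u v → u ∈ s) → 3 ≤ #s → 4 * #s ≤ #G.edgeFinset + 8 →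
      HasCompleteMinor G 6 := by
  induction hn : #s using Nat.strong_induction_on generalizing s with
  | _ n ih =>
    subst hn
    intro G hs h3 hE
    obtain ⟨G', hle, hE'⟩ := exists_le_card_edgeFinset_eq (by omega : 4 * #s - 8 ≤ #G.edgeFinset)
    exact (hasCompleteMinor_of_card_edgeFinset_eq (fun u v h => hs u v (hle h)) h3 (by omega)
      (fun s' G' hlt h1 h2 h3 => ih _ hlt s' rfl G' h1 h2 h3)).mono hle

end DenseGraphs

section DoubleCritical

variable {V : Type} {G : SimpleGraph V}

open Classical in
theorem exists_common_neighbor_of_coloring (h5 : ¬G.Colorable 5) {x y : V} (hxy : G.Adj x y)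
    (c : (G.induce ({x, y}ᶜ : Set V)).Coloring (Fin 4)) (i : Fin 4) :
    ∃ z : ({x, y}ᶜ : Set V), c z = i ∧ G.Adj x z ∧ G.Adj y z := by
  by_contra! hno
  have hmem {v : V} (hvx : v ≠ x) (hvy : v ≠ y) : v ∈ ({x, y}ᶜ : Set V) := by simp [hvx, hvy]
  let col : V → Option (Fin 4) := fun v =>
    if hx : v = x then some i else if hy : v = y then none
    else if c ⟨v, hmem hx hy⟩ = i ∧ G.Adj x v then none else some (c ⟨v, hmem hx hy⟩)
  have hcol (v : V) (hvx : v ≠ x) (hvy : v ≠ y) : col v =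
      if c ⟨v, hmem hvx hvy⟩ = i ∧ G.Adj x v then none else some (c ⟨v, hmem hvx hvy⟩) := by
    simp [col, hvx, hvy]
  have hcolx : col x = some i := by simp [col]
  have hcoly : col y = none := by simp [col, hxy.ne']
  have hxv (v : V) (hxv : G.Adj x v) : col x ≠ col v := by
    by_cases hvy : v = y
    · simp [hvy, hcolx, hcoly]
    · rw [hcolx, hcol v hxv.ne' hvy]
      split_ifs with h
      · simp
      · exact fun h' => h ⟨(Option.some_injective _ h').symm, hxv⟩
  have hyv (v : V) (hvx : v ≠ x) (hyv : G.Adj y v) : col y ≠ col v := by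
    rw [hcoly, hcol v hvx hyv.ne']
    split_ifs with h
    · exact absurd hyv (hno ⟨v, hmem hvx hyv.ne'⟩ h.1 h.2)
    · simp
  have hcolor : G.Coloring (Option (Fin 4)) := Coloring.mk col fun {u v} huv => by
    by_cases hux : u = x
    · exact hux ▸ hxv v (hux ▸ huv)
    by_cases hvx : v = x
    · exact hvx ▸ (hxv u (hvx ▸ huv.symm)).symm
    by_cases huy : u = y
    · exact huy ▸ hyv v hvx (huy ▸ huv)
    by_cases hvy : v = y
    · exact hvy ▸ (hyv u hux (hvy ▸ huv.symm)).symm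
    have hc : c ⟨u, hmem hux huy⟩ ≠ c ⟨v, hmem hvx hvy⟩ := c.valid huv
    rw [hcol u hux huy, hcol v hvx hvy]
    split_ifs with h1 h2
    · exact absurd (h1.1.trans h2.1.symm) hc
    · simp
    · simp
    · exact fun h => hc (Option.some_injective _ h)
  exact h5 (by simpa using hcolor.colorable)

open Classical Finset in
theorem four_le_card_common_neighbors [Fintype V] (h5 : ¬G.Colorable 5)
    (h4 : ∀ x y, G.Adj x y → (G.induce ({x, y}ᶜ : Set V)).Colorable 4) {x y : V}
    (hxy : G.Adj x y) : 4 ≤ #{z | G.Adj x z ∧ G.Adj y z} := by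
  obtain ⟨c⟩ := h4 x y hxy
  choose f hf hfx hfy using exists_common_neighbor_of_coloring h5 hxy c
  have hinj : Function.Injective fun i => (f i : V) := fun i j hij => by
    rw [← hf i, ← hf j, Subtype.ext hij]
  rw [← Fintype.card_fin 4, ← Finset.card_univ, ← card_image_of_injective univ hinj]
  refine card_le_card fun z hz => ?_
  obtain ⟨i, -, rfl⟩ := mem_image.1 hz
  simp [hfx i, hfy i]

theorem exists_adj_not_adj_of_coloring (h5 : ¬G.Colorable 5)
    (h4 : ∀ x y, G.Adj x y → (G.induce ({x, y}ᶜ : Set V)).Colorable 4) {x p q : V}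
    (hxp : G.Adj x p) (hxq : q ≠ x) (hpq : q ≠ p) :
    ∃ z, G.Adj x z ∧ G.Adj p z ∧ ¬G.Adj q z := by
  obtain ⟨c⟩ := h4 x p hxp
  have hq : q ∈ ({x, p}ᶜ : Set V) := by simp [hxq, hpq]
  obtain ⟨z, hz, hxz, hpz⟩ := exists_common_neighbor_of_coloring h5 hxp c (c ⟨q, hq⟩)
  refine ⟨z, hxz, hpz, fun hqz => ?_⟩
  exact c.valid (show (G.induce _).Adj ⟨q, hq⟩ z from hqz) hz.symm

/-- An isolated vertex does not affect the number of colours. -/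
theorem colorable_of_induce_compl_singleton {n : ℕ} {v : V} (hv : ∀ w, ¬G.Adj v w)
    (h : (G.induce ({v}ᶜ : Set V)).Colorable (n + 1)) : G.Colorable (n + 1) := by
  classical
  obtain ⟨c⟩ := h
  refine ⟨Coloring.mk (fun w => if hw : w = v then 0 else c ⟨w, hw⟩) fun {a b} hab => ?_⟩
  have ha : a ≠ v := by
    rintro rfl
    exact hv b hab
  have hb : b ≠ v := by
    rintro rfl
    exact hv a hab.symm
  simp only [ha, hb, dif_neg, not_false_eq_true]
  exact c.valid (show (G.induce _).Adj ⟨a, ha⟩ ⟨b, hb⟩ from hab)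

end DoubleCritical

/-- Every double-critical `6`-chromatic graph contains `K₆` as a minor. -/
theorem stmt16 {V : Type} [Fintype V] (G : SimpleGraph V)
    (hdc : DoubleCritical G) (hchrom : G.chromaticNumber = 6) :
    HasCompleteMinor G 6 := by
  classical
  obtain ⟨hvc, hdc⟩ := hdc
  rw [hchrom] at hdc
  have h5 : ¬G.Colorable 5 := fun h => by
    have := chromaticNumber_le_iff_colorable.2 h
    rw [hchrom] at this
    exact absurd this (by decide)
  have h4 (x y : V) (hxy : G.Adj x y) : (G.induce ({x, y}ᶜ : Set V)).Colorable 4 := by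
    refine chromaticNumber_le_iff_colorable.1 (WithTop.le_of_add_le_add_right (z := 2) ?_ ?_)
    · decide
    · exact hdc x y hxy
  have hneighbor (v : V) : ∃ w, G.Adj v w := by
    by_contra! hv
    refine h5 (colorable_of_induce_compl_singleton hv (chromaticNumber_le_iff_colorable.1 ?_))
    refine Order.le_of_lt_add_one ((hvc v).trans_eq ?_)
    rw [hchrom]
    rfl
  have hdeg (v : V) : 5 ≤ G.degree v := by
    obtain ⟨w, hw⟩ := hneighbor v
    have h1 := card_filter_adj_add (G := G) ((G.mem_neighborFinset v w).2 hw)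
    rw [card_filter_neighborFinset, card_neighborFinset_eq_degree] at h1
    have := four_le_card_common_neighbors h5 h4 hw
    omega
  by_cases hsmall : ∃ x, G.degree x ≤ 7
  · obtain ⟨x, hx⟩ := hsmall
    have hadj (v : V) (hv : v ∈ G.neighborFinset x) : G.Adj x v := (G.mem_neighborFinset x v).1 hv
    have h5' := hdeg x
    rw [← card_neighborFinset_eq_degree] at hx h5'
    refine (hasCompleteMinor_or_isExceptional hadj h5' hx fun v hv => ?_).resolve_right
      fun hex => ?_
    · rw [card_filter_neighborFinset]
      exact four_le_card_common_neighbors h5 h4 (hadj v hv)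
    · obtain ⟨p, hp, q, hq, hpq, -, hdom⟩ := hex.exists_dominated
      obtain ⟨z, hxz, hpz, hqz⟩ := exists_adj_not_adj_of_coloring h5 h4 (hadj p hp)
        (hadj q hq).ne' hpq.symm
      exact hqz (hdom z ((G.mem_neighborFinset x z).2 hxz) hpz)
  · push Not at hsmall
    have : Nonempty V := by
      by_contra h
      rw [not_nonempty_iff] at h
      exact h5 (Colorable.of_isEmpty 5)
    obtain ⟨v⟩ := this
    have hs : ∀ u v, G.Adj u v → u ∈ (Finset.univ : Finset V) := fun u _ _ => Finset.mem_univ u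
    have hsum := Finset.card_nsmul_le_sum Finset.univ _ 8 fun v _ => hsmall v
    rw [sum_degrees_of_support hs, smul_eq_mul] at hsum
    have hcard : 8 < Finset.card (Finset.univ : Finset V) :=
      lt_of_le_of_lt (hsmall v) (by rw [Finset.card_univ]; exact G.degree_lt_card_verts v)
    exact hasCompleteMinor_of_le_card_edgeFinset Finset.univ G hs (by omega) (by omega)
end
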